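/- Let P(λ) = Σ_{i=0}^k λ^i A_i be an m×n matrix polynomial of grade k with m ≤ n and r = nrank P(λ). Let L(λ) ∈ 𝕃₂(P) with nonzero left ansatz vector w ∈ F^k have full Z-rank, and let L_t(λ) = L(λ)D̂ be the pencil obtained by trimming L(λ) with respect to a nonsingular M̂ (with M̂w = αe₁, α ≠ 0) and an admissible D̂ ∈ F^{kn×(n+(k−1)m)}. Then L_t(λ) is a strong linearization of P(λ) such that: (a) every minimal basis of N_l(L_t) is of the form {Λ_k(λ)⊗y₁(λ), …, Λ_k(λ)⊗y_{m−r}(λ)} where {y₁(λ), …, y_{m−r}(λ)} is a minimal basis of N_l(P); (b) the left minimal indices of L_t(λ) are those of P(λ) shifted by k−1; (c) every minimal basis of N_r(P) is of the form {(w^T⊗I_n)D̂ x₁(λ), …, (w^T⊗I_n)D̂ x_{n−r}(λ)} where {x₁(λ), …, x_{n−r}(λ)} is a minimal basis of N_r(L_t); (d) the right minimal indices of P(λ) are equal to those of L_t(λ). -/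

import Mathlib

noncomputable section

open Polynomial Matrix

namespace GLin

variable {F : Type*} [RCLike F]

/-! ### Matrix polynomials and pencils -/

/-- The matrix polynomial `P(λ) = ∑_{i=0}^k λ^i A_i` determined by its
coefficient matrices `A_0, …, A_k` (grade `k`). -/
def matPoly {k m n : ℕ} (A : Fin (k + 1) → Matrix (Fin m) (Fin n) F) :
    Matrix (Fin m) (Fin n) F[X] :=
  Matrix.of fun r c => ∑ i : Fin (k + 1), Polynomial.C (A i r c) * Polynomial.X ^ (i : ℕ)

/-- The matrix pencil `L(λ) = λ X + Y`. -/
def pencil {ρ γ : Type*} (Xc Yc : Matrix ρ γ F) : Matrix ρ γ F[X] :=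
  Matrix.of fun i j => Polynomial.C (Xc i j) * Polynomial.X + Polynomial.C (Yc i j)

/-- `Λ_k(λ) ⊗ I_n` where `Λ_k(λ) = (λ^{k-1}, …, λ, 1)ᵀ`. -/
def Lam (F : Type*) [RCLike F] (k n : ℕ) : Matrix (Fin k × Fin n) (Fin n) F[X] :=
  Matrix.of fun p c => if p.2 = c then Polynomial.X ^ (k - 1 - (p.1 : ℕ)) else 0

/-- `Λ_k(λ)ᵀ ⊗ I_m`. -/
def LamRow (F : Type*) [RCLike F] (k m : ℕ) : Matrix (Fin m) (Fin k × Fin m) F[X] :=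
  Matrix.of fun r p => if r = p.2 then Polynomial.X ^ (k - 1 - (p.1 : ℕ)) else 0

/-- `v ⊗ P(λ)`. -/
def vkron {k m n : ℕ} (v : Fin k → F) (P : Matrix (Fin m) (Fin n) F[X]) :
    Matrix (Fin k × Fin m) (Fin n) F[X] :=
  Matrix.of fun p c => Polynomial.C (v p.1) * P p.2 c

/-- `wᵀ ⊗ P(λ)`. -/
def wkron {k m n : ℕ} (w : Fin k → F) (P : Matrix (Fin m) (Fin n) F[X]) :
    Matrix (Fin m) (Fin k × Fin n) F[X] :=
  Matrix.of fun r q => Polynomial.C (w q.1) * P r q.2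

/-- The defining identity of `𝕃₁(P)`: `L(λ)(Λ_k(λ) ⊗ I_n) = v ⊗ P(λ)`. -/
def RightAnsatz {k m n : ℕ} (P : Matrix (Fin m) (Fin n) F[X])
    (L : Matrix (Fin k × Fin m) (Fin k × Fin n) F[X]) (v : Fin k → F) : Prop :=
  L * Lam F k n = vkron v P

/-- The defining identity of `𝕃₂(P)`: `(Λ_k(λ)ᵀ ⊗ I_m) L(λ) = wᵀ ⊗ P(λ)`. -/
def LeftAnsatz {k m n : ℕ} (P : Matrix (Fin m) (Fin n) F[X])
    (L : Matrix (Fin k × Fin m) (Fin k × Fin n) F[X]) (w : Fin k → F) : Prop :=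
  LamRow F k m * L = wkron w P

/-- The vector `α e₁ ∈ F^k`. -/
def e1 {k : ℕ} (α : F) : Fin k → F := fun i => if (i : ℕ) = 0 then α else 0

/-- `M ⊗ I_m`. -/
def kronId {k m : ℕ} (M : Matrix (Fin k) (Fin k) F) :
    Matrix (Fin k × Fin m) (Fin k × Fin m) F :=
  Matrix.of fun p q => if p.2 = q.2 then M p.1 q.1 else 0

/-! ### (strong) g-linearizations -/

/-- `diag(P(λ), I_{k-1} ⊗ I_{m,n})`. -/
def glinTarget {k m n : ℕ} (P : Matrix (Fin m) (Fin n) F[X]) :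
    Matrix (Fin k × Fin m) (Fin k × Fin n) F[X] :=
  Matrix.of fun p q =>
    if p.1 = q.1 then
      (if (p.1 : ℕ) = 0 then P p.2 q.2 else if (p.2 : ℕ) = (q.2 : ℕ) then 1 else 0)
    else 0

/-- A `km × kn` pencil (or matrix polynomial) `L` is a g-linearization of the `m × n`
matrix polynomial `P` of grade `k` if `E(λ) L(λ) G(λ) = diag(P(λ), I_{k-1} ⊗ I_{m,n})`
for unimodular `E`, `G`. -/
def IsGLin {k m n : ℕ} (P : Matrix (Fin m) (Fin n) F[X])
    (L : Matrix (Fin k × Fin m) (Fin k × Fin n) F[X]) : Prop :=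
  ∃ (E : Matrix (Fin k × Fin m) (Fin k × Fin m) F[X])
    (G : Matrix (Fin k × Fin n) (Fin k × Fin n) F[X]),
      IsUnit E.det ∧ IsUnit G.det ∧ E * L * G = glinTarget P

/-- grade-`N` reversal `rev_N P(λ) = λ^N P(1/λ)`, entrywise. -/
def revMat {ρ γ : Type*} (N : ℕ) (P : Matrix ρ γ F[X]) : Matrix ρ γ F[X] :=
  P.map fun p => Polynomial.reflect N p

/-- Strong g-linearization of the grade-`k` matrix polynomial with coefficients `A`. -/
def IsStrongGLin {k m n : ℕ} (A : Fin (k + 1) → Matrix (Fin m) (Fin n) F)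
    (L : Matrix (Fin k × Fin m) (Fin k × Fin n) F[X]) : Prop :=
  IsGLin (matPoly A) L ∧ IsGLin (revMat k (matPoly A)) (revMat 1 L)

/-! ### linearizations (rectangular, of size `(m+s) × (n+s)`) -/

/-- A matrix polynomial `L` (indexed by arbitrary finite types of cardinalities
`m + s` and `n + s`) is a linearization of `P` if, after identifying the index types
with `Fin m ⊕ Fin s` and `Fin n ⊕ Fin s`, one has `E(λ) L(λ) G(λ) = diag(P(λ), I_s)`
for unimodular `E`, `G`. -/
def IsLin {m n : ℕ} (s : ℕ) (P : Matrix (Fin m) (Fin n) F[X])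
    {ρ γ : Type*} [Fintype ρ] [DecidableEq ρ] [Fintype γ] [DecidableEq γ]
    (L : Matrix ρ γ F[X]) : Prop :=
  ∃ (er : ρ ≃ (Fin m ⊕ Fin s)) (ec : γ ≃ (Fin n ⊕ Fin s))
    (E : Matrix (Fin m ⊕ Fin s) (Fin m ⊕ Fin s) F[X])
    (G : Matrix (Fin n ⊕ Fin s) (Fin n ⊕ Fin s) F[X]),
      IsUnit E.det ∧ IsUnit G.det ∧
        E * Matrix.reindex er ec L * G = Matrix.fromBlocks P 0 0 1

/-- Strong linearization of the grade-`k` matrix polynomial with coefficients `A`. -/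
def IsStrongLin {k m n : ℕ} (s : ℕ) (A : Fin (k + 1) → Matrix (Fin m) (Fin n) F)
    {ρ γ : Type*} [Fintype ρ] [DecidableEq ρ] [Fintype γ] [DecidableEq γ]
    (L : Matrix ρ γ F[X]) : Prop :=
  IsLin s (matPoly A) L ∧ IsLin s (revMat k (matPoly A)) (revMat 1 L)

/-! ### shifted sums -/

/-- Column shifted sum `X ⊞→ Y`. -/
def colShiftSum {k m n : ℕ} (Xc Yc : Matrix (Fin k × Fin m) (Fin k × Fin n) F) :
    Matrix (Fin k × Fin m) (Fin (k + 1) × Fin n) F :=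
  Matrix.of fun p q =>
    (if h : (q.1 : ℕ) < k then Xc p (⟨(q.1 : ℕ), h⟩, q.2) else 0) +
    (if h : 0 < (q.1 : ℕ) then
        Yc p (⟨(q.1 : ℕ) - 1, by have := q.1.isLt; omega⟩, q.2)
      else 0)

/-- Row shifted sum `X ⊞↓ Y`. -/
def rowShiftSum {k m n : ℕ} (Xc Yc : Matrix (Fin k × Fin m) (Fin k × Fin n) F) :
    Matrix (Fin (k + 1) × Fin m) (Fin k × Fin n) F :=
  Matrix.of fun p q =>
    (if h : (p.1 : ℕ) < k then Xc (⟨(p.1 : ℕ), h⟩, p.2) q else 0) +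
    (if h : 0 < (p.1 : ℕ) then
        Yc (⟨(p.1 : ℕ) - 1, by have := p.1.isLt; omega⟩, p.2) q
      else 0)

/-! ### the parametrization of `𝕃₁(P)` and `𝕃₂(P)` -/

/-- `X = [v ⊗ A_k ∣ -W]`. -/
def L1X {k m n : ℕ} (A : Fin (k + 1) → Matrix (Fin m) (Fin n) F) (v : Fin k → F)
    (W : Matrix (Fin k × Fin m) (Fin (k - 1) × Fin n) F) :
    Matrix (Fin k × Fin m) (Fin k × Fin n) F :=
  Matrix.of fun p q =>
    if h : (q.1 : ℕ) = 0 then v p.1 * A (Fin.last k) p.2 q.2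
    else -W p (⟨(q.1 : ℕ) - 1, by have := q.1.isLt; omega⟩, q.2)

/-- `Y = [W + v ⊗ [A_{k-1} ⋯ A_1] ∣ v ⊗ A_0]`. -/
def L1Y {k m n : ℕ} (A : Fin (k + 1) → Matrix (Fin m) (Fin n) F) (v : Fin k → F)
    (W : Matrix (Fin k × Fin m) (Fin (k - 1) × Fin n) F) :
    Matrix (Fin k × Fin m) (Fin k × Fin n) F :=
  Matrix.of fun p q =>
    if h : (q.1 : ℕ) < k - 1 then
      W p (⟨(q.1 : ℕ), h⟩, q.2) + v p.1 * A (⟨k - 1 - (q.1 : ℕ), by omega⟩) p.2 q.2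
    else v p.1 * A 0 p.2 q.2

/-- `X = [wᵀ ⊗ A_k ; -Ŵ]`. -/
def L2X {k m n : ℕ} (A : Fin (k + 1) → Matrix (Fin m) (Fin n) F) (w : Fin k → F)
    (W : Matrix (Fin (k - 1) × Fin m) (Fin k × Fin n) F) :
    Matrix (Fin k × Fin m) (Fin k × Fin n) F :=
  Matrix.of fun p q =>
    if h : (p.1 : ℕ) = 0 then w q.1 * A (Fin.last k) p.2 q.2
    else -W (⟨(p.1 : ℕ) - 1, by have := p.1.isLt; omega⟩, p.2) q

/-- `Y = [Ŵ + wᵀ ⊗ [A_{k-1}ᵀ ⋯ A_1ᵀ]ᵀ ; wᵀ ⊗ A_0]`. -/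
def L2Y {k m n : ℕ} (A : Fin (k + 1) → Matrix (Fin m) (Fin n) F) (w : Fin k → F)
    (W : Matrix (Fin (k - 1) × Fin m) (Fin k × Fin n) F) :
    Matrix (Fin k × Fin m) (Fin k × Fin n) F :=
  Matrix.of fun p q =>
    if h : (p.1 : ℕ) < k - 1 then
      W (⟨(p.1 : ℕ), h⟩, p.2) q + w q.1 * A (⟨k - 1 - (p.1 : ℕ), by omega⟩) p.2 q.2
    else w q.1 * A 0 p.2 q.2

/-! ### block structure and `Z`-matrices -/

/-- Assemble a `km × kn` matrix from blocks with row split `m + (k-1)m` and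
column split `n + (k-1)n`. -/
def blk {k m n : ℕ} (TL : Matrix (Fin m) (Fin n) F)
    (TR : Matrix (Fin m) (Fin (k - 1) × Fin n) F)
    (BL : Matrix (Fin (k - 1) × Fin m) (Fin n) F)
    (BR : Matrix (Fin (k - 1) × Fin m) (Fin (k - 1) × Fin n) F) :
    Matrix (Fin k × Fin m) (Fin k × Fin n) F :=
  Matrix.of fun p q =>
    if hp : (p.1 : ℕ) = 0 then
      if hq : (q.1 : ℕ) = 0 then TL p.2 q.2
      else TR p.2 (⟨(q.1 : ℕ) - 1, by have := q.1.isLt; omega⟩, q.2)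
    else
      if hq : (q.1 : ℕ) = 0 then
        BL (⟨(p.1 : ℕ) - 1, by have := p.1.isLt; omega⟩, p.2) q.2
      else
        BR (⟨(p.1 : ℕ) - 1, by have := p.1.isLt; omega⟩, p.2)
          (⟨(q.1 : ℕ) - 1, by have := q.1.isLt; omega⟩, q.2)

/-- Assemble `[[Y₁₁, T],[Z, 0]]`, row split `m + (k-1)m`, column split `(k-1)n + n`. -/
def blkY1 {k m n : ℕ} (Y11 : Matrix (Fin m) (Fin (k - 1) × Fin n) F)
    (T : Matrix (Fin m) (Fin n) F)
    (Z : Matrix (Fin (k - 1) × Fin m) (Fin (k - 1) × Fin n) F) :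
    Matrix (Fin k × Fin m) (Fin k × Fin n) F :=
  Matrix.of fun p q =>
    if hp : (p.1 : ℕ) = 0 then
      if hq : (q.1 : ℕ) < k - 1 then Y11 p.2 (⟨(q.1 : ℕ), hq⟩, q.2) else T p.2 q.2
    else
      if hq : (q.1 : ℕ) < k - 1 then
        Z (⟨(p.1 : ℕ) - 1, by have := p.1.isLt; omega⟩, p.2) (⟨(q.1 : ℕ), hq⟩, q.2)
      else 0

/-- Assemble `[[Y₁₁, Z],[T, 0]]`, row split `(k-1)m + m`, column split `n + (k-1)n`. -/
def blkY2 {k m n : ℕ} (Y11 : Matrix (Fin (k - 1) × Fin m) (Fin n) F)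
    (Z : Matrix (Fin (k - 1) × Fin m) (Fin (k - 1) × Fin n) F)
    (T : Matrix (Fin m) (Fin n) F) :
    Matrix (Fin k × Fin m) (Fin k × Fin n) F :=
  Matrix.of fun p q =>
    if hp : (p.1 : ℕ) < k - 1 then
      if hq : (q.1 : ℕ) = 0 then Y11 (⟨(p.1 : ℕ), hp⟩, p.2) q.2
      else Z (⟨(p.1 : ℕ), hp⟩, p.2) (⟨(q.1 : ℕ) - 1, by have := q.1.isLt; omega⟩, q.2)
    else
      if hq : (q.1 : ℕ) = 0 then T p.2 q.2 else 0

/-- The `Z`-matrix of `L = λX + Y ∈ 𝕃₁(P)` with respect to `M`: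
the lower-left `(k-1)m × (k-1)n` block of `(M ⊗ I_m) Y`. -/
def Zmat1 {k m n : ℕ} (M : Matrix (Fin k) (Fin k) F)
    (Yc : Matrix (Fin k × Fin m) (Fin k × Fin n) F) :
    Matrix (Fin (k - 1) × Fin m) (Fin (k - 1) × Fin n) F :=
  Matrix.of fun p q =>
    (kronId M * Yc : Matrix (Fin k × Fin m) (Fin k × Fin n) F)
      (⟨(p.1 : ℕ) + 1, by have := p.1.isLt; omega⟩, p.2)
      (⟨(q.1 : ℕ), by have := q.1.isLt; omega⟩, q.2)

/-- The `Z`-matrix of `L = λX + Y ∈ 𝕃₂(P)` with respect to `M̂`: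
the upper-right `(k-1)m × (k-1)n` block of `Y (M̂ᵀ ⊗ I_n)`. -/
def Zmat2 {k m n : ℕ} (M : Matrix (Fin k) (Fin k) F)
    (Yc : Matrix (Fin k × Fin m) (Fin k × Fin n) F) :
    Matrix (Fin (k - 1) × Fin m) (Fin (k - 1) × Fin n) F :=
  Matrix.of fun p q =>
    (Yc * kronId Mᵀ : Matrix (Fin k × Fin m) (Fin k × Fin n) F)
      (⟨(p.1 : ℕ), by have := p.1.isLt; omega⟩, p.2)
      (⟨(q.1 : ℕ) + 1, by have := q.1.isLt; omega⟩, q.2)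

/-- `L = λX + Y ∈ 𝕃₁(P)` with right ansatz vector `v` has full `Z`-rank. -/
def FullZrank1 {k m n : ℕ} (Yc : Matrix (Fin k × Fin m) (Fin k × Fin n) F)
    (v : Fin k → F) : Prop :=
  ∃ (M : Matrix (Fin k) (Fin k) F) (α : F),
    IsUnit M ∧ α ≠ 0 ∧ M.mulVec v = e1 α ∧ (Zmat1 M Yc).rank = (k - 1) * n

/-- `L = λX + Y ∈ 𝕃₂(P)` with left ansatz vector `w` has full `Z`-rank. -/
def FullZrank2 {k m n : ℕ} (Yc : Matrix (Fin k × Fin m) (Fin k × Fin n) F)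
    (w : Fin k → F) : Prop :=
  ∃ (M : Matrix (Fin k) (Fin k) F) (α : F),
    IsUnit M ∧ α ≠ 0 ∧ M.mulVec w = e1 α ∧ (Zmat2 M Yc).rank = (k - 1) * m

/-! ### null spaces, minimal bases and minimal indices over `F(λ)` -/

/-- A matrix polynomial viewed as a matrix over the field of rational functions. -/
def matRF {ρ γ : Type*} (P : Matrix ρ γ F[X]) : Matrix ρ γ (RatFunc F) :=
  P.map (algebraMap F[X] (RatFunc F))

/-- The right null space `N_r(P) = {x(λ) : P(λ) x(λ) ≡ 0}` over `F(λ)`. -/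
def Nr {ρ γ : Type*} [Fintype γ] (P : Matrix ρ γ F[X]) :
    Submodule (RatFunc F) (γ → RatFunc F) :=
  LinearMap.ker (Matrix.mulVecLin (matRF P))

/-- The left null space `N_l(P) = {y(λ) : y(λ)ᵀ P(λ) ≡ 0}` over `F(λ)`. -/
def Nl {ρ γ : Type*} [Fintype ρ] (P : Matrix ρ γ F[X]) :
    Submodule (RatFunc F) (ρ → RatFunc F) :=
  Nr Pᵀ

/-- The normal rank of a matrix polynomial: its rank over `F(λ)`. -/
def nrank {ρ γ : Type*} [Fintype γ] (P : Matrix ρ γ F[X]) : ℕ :=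
  (matRF P).rank

/-- The rational vector determined by a vector polynomial. -/
def polyVec {γ : Type*} (x : γ → F[X]) : γ → RatFunc F :=
  fun i => algebraMap F[X] (RatFunc F) (x i)

/-- A rational vector is a vector polynomial if all its entries are polynomials. -/
def IsVecPoly {γ : Type*} (x : γ → RatFunc F) : Prop :=
  ∃ p : γ → F[X], x = polyVec p

/-- The degree of a vector polynomial: the greatest degree of its components. -/
def polyVecDeg {γ : Type*} [Fintype γ] (x : γ → F[X]) : ℕ :=
  Finset.univ.sup fun i => (x i).natDegree

/-- A polynomial basis of the subspace `V` of `F(λ)^γ`. -/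
def IsPolyBasis {γ ι : Type*} [Fintype γ]
    (V : Submodule (RatFunc F) (γ → RatFunc F)) (b : ι → γ → F[X]) : Prop :=
  LinearIndependent (RatFunc F) (fun i => polyVec (b i)) ∧
    Submodule.span (RatFunc F) (Set.range fun i => polyVec (b i)) = V

/-- A minimal basis of `V`: a polynomial basis of least order (sum of degrees). -/
def IsMinimalBasis {γ ι : Type*} [Fintype γ] [Fintype ι]
    (V : Submodule (RatFunc F) (γ → RatFunc F)) (b : ι → γ → F[X]) : Prop :=
  IsPolyBasis V b ∧
    ∀ (d : ℕ) (b' : Fin d → γ → F[X]), IsPolyBasis V b' →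
      ∑ i, polyVecDeg (b i) ≤ ∑ i, polyVecDeg (b' i)

/-- `ε` is the list of minimal indices of `V`: some minimal basis of `V` has
`ε` as its list of degrees. -/
def HasMinIndices {γ : Type*} [Fintype γ]
    (V : Submodule (RatFunc F) (γ → RatFunc F)) {d : ℕ} (ε : Fin d → ℕ) : Prop :=
  ∃ b : Fin d → γ → F[X], IsMinimalBasis V b ∧ ∀ i, polyVecDeg (b i) = ε i

/-- `Λ_k(λ) ⊗ x(λ)`. -/
def lamTensor {n : ℕ} (k : ℕ) (x : Fin n → RatFunc F) : Fin k × Fin n → RatFunc F :=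
  fun p => algebraMap F[X] (RatFunc F) (Polynomial.X ^ (k - 1 - (p.1 : ℕ))) * x p.2

/-- The matrix `vᵀ ⊗ I_m` over `F(λ)`; `𝓛_v(y) = (vproj v).mulVec y`. -/
def vproj {k m : ℕ} (v : Fin k → F) : Matrix (Fin m) (Fin k × Fin m) (RatFunc F) :=
  Matrix.of fun r p =>
    if r = p.2 then algebraMap F[X] (RatFunc F) (Polynomial.C (v p.1)) else 0

/-- `(vᵀ ⊗ I_m) y` at the level of vector polynomials. -/
def LvPoly {k m : ℕ} (v : Fin k → F) (y : Fin k × Fin m → F[X]) : Fin m → F[X] :=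
  fun r => ∑ i : Fin k, Polynomial.C (v i) * y (i, r)

/-- The rational subspace spanned by the rows of a matrix polynomial. -/
def rowSpan {ρ γ : Type*} [Fintype γ] (B : Matrix ρ γ F[X]) :
    Submodule (RatFunc F) (γ → RatFunc F) :=
  Submodule.span (RatFunc F) (Set.range fun i => polyVec (B i))

/-- A matrix polynomial is a minimal basis if its rows form a minimal basis of the
rational subspace they span. -/
def IsMinimalBasisMat {ρ γ : Type*} [Fintype ρ] [Fintype γ] (B : Matrix ρ γ F[X]) : Prop :=
  IsMinimalBasis (rowSpan B) (fun i => B i)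

/-- Dual minimal bases: `B ∈ F[λ]^{n₁×n}`, `C ∈ F[λ]^{n₂×n}` minimal bases with
`n₁ + n₂ = n` and `B Cᵀ = 0`. -/
def DualMinBases {ρ ρ' γ : Type*} [Fintype ρ] [Fintype ρ'] [Fintype γ]
    (B : Matrix ρ γ F[X]) (Cm : Matrix ρ' γ F[X]) : Prop :=
  IsMinimalBasisMat B ∧ IsMinimalBasisMat Cm ∧
    Fintype.card ρ + Fintype.card ρ' = Fintype.card γ ∧ B * Cmᵀ = 0

/-! ### norms, singular values -/

/-- Square of the Frobenius norm of a constant matrix. -/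
def frobSq {ρ γ : Type*} [Fintype ρ] [Fintype γ] (Ac : Matrix ρ γ F) : ℝ :=
  ∑ i, ∑ j, ‖Ac i j‖ ^ 2

/-- `‖λX + Y‖_F = sqrt(‖X‖_F² + ‖Y‖_F²)`. -/
def penFrob {ρ γ : Type*} [Fintype ρ] [Fintype γ] (Xc Yc : Matrix ρ γ F) : ℝ :=
  Real.sqrt (frobSq Xc + frobSq Yc)

/-- `‖P‖_F = sqrt(∑ ‖A_i‖_F²)` for `P(λ) = ∑ λ^i A_i`. -/
def famFrob {k m n : ℕ} (A : Fin (k + 1) → Matrix (Fin m) (Fin n) F) : ℝ :=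
  Real.sqrt (∑ i, frobSq (A i))

/-- `‖P‖_F` for a matrix polynomial of grade `g`. -/
def mpolyFrob {ρ γ : Type*} [Fintype ρ] [Fintype γ] (g : ℕ) (P : Matrix ρ γ F[X]) : ℝ :=
  Real.sqrt (∑ i, ∑ j, ∑ d ∈ Finset.range (g + 1), ‖(P i j).coeff d‖ ^ 2)

/-- Square of the Euclidean norm of a vector. -/
def vecNormSq {ι : Type*} [Fintype ι] (x : ι → F) : ℝ := ∑ i, ‖x i‖ ^ 2

/-- The smallest singular value of a matrix. -/
def sigmaMin {ρ γ : Type*} [Fintype ρ] [Fintype γ] (Ac : Matrix ρ γ F) : ℝ :=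
  if Fintype.card γ ≤ Fintype.card ρ then
    sInf {r : ℝ | ∃ x : γ → F, vecNormSq x = 1 ∧ r = Real.sqrt (vecNormSq (Ac.mulVec x))}
  else
    sInf {r : ℝ | ∃ y : ρ → F, vecNormSq y = 1 ∧ r = Real.sqrt (vecNormSq (Acᴴ.mulVec y))}

/-- The spectral norm (2-norm) of a matrix. -/
def norm2 {ρ γ : Type*} [Fintype ρ] [Fintype γ] (Ac : Matrix ρ γ F) : ℝ :=
  sSup {r : ℝ | ∃ x : γ → F, vecNormSq x = 1 ∧ r = Real.sqrt (vecNormSq (Ac.mulVec x))}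

/-- `κ₂(D) = ‖D‖₂ ‖D⁻¹‖₂`. -/
def cond2 {ρ : Type*} [Fintype ρ] [DecidableEq ρ] (Dc : Matrix ρ ρ F) : ℝ :=
  norm2 Dc * norm2 Dc⁻¹

/-! ### pencils used in the backward error analysis -/

/-- `B(λ) = λ [0 ∣ -R̃] + [R̃ ∣ 0]`, i.e. `R̃ (H_{k-1}(λ) ⊗ I_n)` up to sign conventions. -/
def Bpencil {k n : ℕ} (R : Matrix (Fin (k - 1) × Fin n) (Fin (k - 1) × Fin n) F) :
    Matrix (Fin (k - 1) × Fin n) (Fin k × Fin n) F[X] :=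
  Matrix.of fun p q =>
    (if h : (q.1 : ℕ) < k - 1 then Polynomial.C (R p (⟨(q.1 : ℕ), h⟩, q.2)) else 0) +
    (if h : 0 < (q.1 : ℕ) then
        Polynomial.X *
          Polynomial.C (-R p (⟨(q.1 : ℕ) - 1, by have := q.1.isLt; omega⟩, q.2))
      else 0)

/-- The coefficient of `λ` in `H_{k-1}(λ) ⊗ I_n`. -/
def Hlam (F : Type*) [RCLike F] (k n : ℕ) :
    Matrix (Fin (k - 1) × Fin n) (Fin k × Fin n) F :=
  Matrix.of fun p q => if p.2 = q.2 ∧ (q.1 : ℕ) = (p.1 : ℕ) + 1 then 1 else 0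

/-- The constant coefficient of `H_{k-1}(λ) ⊗ I_n`. -/
def Hconst (F : Type*) [RCLike F] (k n : ℕ) :
    Matrix (Fin (k - 1) × Fin n) (Fin k × Fin n) F :=
  Matrix.of fun p q => if p.2 = q.2 ∧ (q.1 : ℕ) = (p.1 : ℕ) then -1 else 0

/-- The convolution matrix `C_j(λ Xc + Yc)` of a pencil, with `j+1` block columns. -/
def convPencil {ρ γ : Type*} (Xc Yc : Matrix ρ γ F) (j : ℕ) :
    Matrix (Fin (j + 2) × ρ) (Fin (j + 1) × γ) F :=
  Matrix.of fun r c =>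
    if (r.1 : ℕ) = (c.1 : ℕ) then Xc r.2 c.2
    else if (r.1 : ℕ) = (c.1 : ℕ) + 1 then Yc r.2 c.2 else 0

/-- λ-coefficient of the trimmed pencil `L̂_t(λ)`:
`[[α A_k, X₁₂],[0, -R̃]]` with row split `m + (k-1)n`. -/
def LtX {k m n : ℕ} (α : F) (Ak : Matrix (Fin m) (Fin n) F)
    (X12 : Matrix (Fin m) (Fin (k - 1) × Fin n) F)
    (R : Matrix (Fin (k - 1) × Fin n) (Fin (k - 1) × Fin n) F) :
    Matrix (Fin m ⊕ (Fin (k - 1) × Fin n)) (Fin k × Fin n) F :=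
  Matrix.of fun s q =>
    Sum.elim
      (fun r => if h : (q.1 : ℕ) = 0 then α * Ak r q.2
        else X12 r (⟨(q.1 : ℕ) - 1, by have := q.1.isLt; omega⟩, q.2))
      (fun p => if h : (q.1 : ℕ) = 0 then 0
        else -R p (⟨(q.1 : ℕ) - 1, by have := q.1.isLt; omega⟩, q.2)) s

/-- Constant coefficient of the trimmed pencil `L̂_t(λ)`:
`[[Y₁₁, α A₀],[R̃, 0]]` with row split `m + (k-1)n`. -/
def LtY {k m n : ℕ} (α : F) (A0 : Matrix (Fin m) (Fin n) F)
    (Y11 : Matrix (Fin m) (Fin (k - 1) × Fin n) F)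
    (R : Matrix (Fin (k - 1) × Fin n) (Fin (k - 1) × Fin n) F) :
    Matrix (Fin m ⊕ (Fin (k - 1) × Fin n)) (Fin k × Fin n) F :=
  Matrix.of fun s q =>
    Sum.elim
      (fun r => if h : (q.1 : ℕ) < k - 1 then Y11 r (⟨(q.1 : ℕ), h⟩, q.2)
        else α * A0 r q.2)
      (fun p => if h : (q.1 : ℕ) < k - 1 then R p (⟨(q.1 : ℕ), h⟩, q.2) else 0) s

/-! ### trimming -/

/-- The rows `[0 ∣ Q₂*] (M ⊗ I_m)`. -/
def bottomRows {k m n c : ℕ} (M : Matrix (Fin k) (Fin k) F)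
    (Q : Matrix (Fin (k - 1) × Fin m) ((Fin (k - 1) × Fin n) ⊕ Fin c) F) :
    Matrix (Fin c) (Fin k × Fin m) F :=
  (Matrix.of fun (j : Fin c) (p : Fin k × Fin m) =>
      if h : (p.1 : ℕ) = 0 then 0
      else star (Q (⟨(p.1 : ℕ) - 1, by have := p.1.isLt; omega⟩, p.2) (Sum.inr j)))
    * kronId M

/-- The square matrix `[D ; [0 ∣ Q₂*](M ⊗ I_m)]` whose invertibility makes `D` admissible. -/
def trimAux {k m n c : ℕ} (M : Matrix (Fin k) (Fin k) F)
    (Q : Matrix (Fin (k - 1) × Fin m) ((Fin (k - 1) × Fin n) ⊕ Fin c) F)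
    (D : Matrix (Fin m ⊕ (Fin (k - 1) × Fin n)) (Fin k × Fin m) F) :
    Matrix ((Fin m ⊕ (Fin (k - 1) × Fin n)) ⊕ Fin c) (Fin k × Fin m) F :=
  Matrix.of (Sum.elim (fun i j => D i j) (fun i j => bottomRows M Q i j))

/-- The columns `(M̂ᵀ ⊗ I_n) [0 ; Q₂]`. -/
def rightCols {k m n c : ℕ} (M : Matrix (Fin k) (Fin k) F)
    (Q : Matrix (Fin (k - 1) × Fin n) ((Fin (k - 1) × Fin m) ⊕ Fin c) F) :
    Matrix (Fin k × Fin n) (Fin c) F :=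
  kronId Mᵀ *
    (Matrix.of fun (q : Fin k × Fin n) (j : Fin c) =>
      if h : (q.1 : ℕ) = 0 then 0
      else Q (⟨(q.1 : ℕ) - 1, by have := q.1.isLt; omega⟩, q.2) (Sum.inr j))

/-- The square matrix `[D̂ ∣ (M̂ᵀ ⊗ I_n)[0 ; Q₂]]` whose invertibility makes `D̂` admissible. -/
def trimAux2 {k m n c : ℕ} (M : Matrix (Fin k) (Fin k) F)
    (Q : Matrix (Fin (k - 1) × Fin n) ((Fin (k - 1) × Fin m) ⊕ Fin c) F)
    (D : Matrix (Fin k × Fin n) (Fin n ⊕ (Fin (k - 1) × Fin m)) F) :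
    Matrix (Fin k × Fin n) ((Fin n ⊕ (Fin (k - 1) × Fin m)) ⊕ Fin c) F :=
  Matrix.of fun q s => Sum.elim (fun t => D q t) (fun j => rightCols M Q q j) s

/-! ### Transfer of minimal bases between isomorphic null spaces -/

section Transfer

variable {ρ ρ' γ γ' ι : Type*}

lemma polyVec_injective : Function.Injective (polyVec : (γ → F[X]) → γ → RatFunc F) :=
  fun _ _ h => _root_.funext fun i => RatFunc.algebraMap_injective F (congrFun h i)

lemma polyVec_mulVec [Fintype γ] (N : Matrix ρ γ F[X]) (x : γ → F[X]) :
    polyVec (N *ᵥ x) = matRF N *ᵥ polyVec x :=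
  _root_.funext fun i => RingHom.map_mulVec (algebraMap F[X] (RatFunc F)) N x i

lemma matRF_mul [Fintype γ] (N : Matrix ρ γ F[X]) (K : Matrix γ γ' F[X]) :
    matRF (N * K) = matRF N * matRF K :=
  Matrix.map_mul

lemma mem_Nr [Fintype γ] {N : Matrix ρ γ F[X]} {x : γ → RatFunc F} :
    x ∈ Nr N ↔ matRF N *ᵥ x = 0 :=
  Iff.rfl

lemma polyVec_mem_Nr [Fintype γ] {N : Matrix ρ γ F[X]} {x : γ → F[X]} :
    polyVec x ∈ Nr N ↔ N *ᵥ x = 0 := by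
  rw [mem_Nr, ← polyVec_mulVec]
  exact ⟨fun h => polyVec_injective (h.trans (by ext; simp [polyVec])),
    fun h => by rw [h]; ext; simp [polyVec]⟩

/-- `Φ` and `Ψ` induce mutually inverse isomorphisms between the right null spaces of
`P` and `N`. -/
structure NullEquiv [Fintype ρ] [Fintype ρ'] [Fintype γ] [Fintype γ'] [DecidableEq γ]
    [DecidableEq γ'] (P : Matrix ρ γ F[X]) (N : Matrix ρ' γ' F[X])
    (Φ : Matrix γ' γ F[X]) (Ψ : Matrix γ γ' F[X]) : Prop where
  map : ∃ K : Matrix ρ' ρ F[X], N * Φ = K * P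
  comap : ∃ K : Matrix ρ ρ' F[X], P * Ψ = K * N
  left_inv : ∃ K : Matrix γ ρ F[X], Ψ * Φ + K * P = 1
  right_inv : ∃ K : Matrix γ' ρ' F[X], Φ * Ψ + K * N = 1

namespace NullEquiv

variable [Fintype ρ] [Fintype ρ'] [Fintype γ] [Fintype γ'] [DecidableEq γ]
    [DecidableEq γ'] {P : Matrix ρ γ F[X]} {N : Matrix ρ' γ' F[X]}
    {Φ : Matrix γ' γ F[X]} {Ψ : Matrix γ γ' F[X]}

lemma symm (h : NullEquiv P N Φ Ψ) : NullEquiv N P Ψ Φ :=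
  ⟨h.comap, h.map, h.right_inv, h.left_inv⟩

lemma mulVec_mem (h : NullEquiv P N Φ Ψ) {x : γ → RatFunc F} (hx : x ∈ Nr P) :
    matRF Φ *ᵥ x ∈ Nr N := by
  obtain ⟨K, hK⟩ := h.map
  rw [mem_Nr] at hx ⊢
  rw [mulVec_mulVec, ← matRF_mul, hK, matRF_mul, ← mulVec_mulVec, hx, mulVec_zero]

lemma mulVec_mulVec_cancel (h : NullEquiv P N Φ Ψ) {x : γ → RatFunc F} (hx : x ∈ Nr P) :
    matRF Ψ *ᵥ (matRF Φ *ᵥ x) = x := by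
  obtain ⟨K, hK⟩ := h.left_inv
  have h1 : matRF (Ψ * Φ + K * P) *ᵥ x = x := by
    rw [hK, matRF, Matrix.map_one _ (map_zero _) (map_one _), one_mulVec]
  have h2 : matRF (Ψ * Φ + K * P) = matRF Ψ * matRF Φ + matRF K * matRF P := by
    rw [← matRF_mul, ← matRF_mul]
    exact Matrix.map_add _ (map_add _) _ _
  rw [h2, add_mulVec, ← mulVec_mulVec, ← mulVec_mulVec, mem_Nr.mp hx, mulVec_zero,
    add_zero] at h1
  exact h1

lemma mulVec_eq_zero (h : NullEquiv P N Φ Ψ) {x : γ → F[X]} (hx : P *ᵥ x = 0) :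
    N *ᵥ (Φ *ᵥ x) = 0 :=
  polyVec_mem_Nr.mp (polyVec_mulVec Φ x ▸ h.mulVec_mem (polyVec_mem_Nr.mpr hx))

lemma poly_cancel (h : NullEquiv P N Φ Ψ) {x : γ → F[X]} (hx : P *ᵥ x = 0) :
    Ψ *ᵥ (Φ *ᵥ x) = x :=
  polyVec_injective (by
    rw [polyVec_mulVec, polyVec_mulVec, h.mulVec_mulVec_cancel (polyVec_mem_Nr.mpr hx)])

lemma isPolyBasis (h : NullEquiv P N Φ Ψ) {b : ι → γ → F[X]} (hb : IsPolyBasis (Nr P) b) :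
    IsPolyBasis (Nr N) fun i => Φ *ᵥ b i := by
  have hcomp : (fun i => polyVec (Φ *ᵥ b i)) = (matRF Φ).mulVecLin ∘ fun i => polyVec (b i) :=
    _root_.funext fun i => polyVec_mulVec _ _
  refine ⟨?_, ?_⟩
  · rw [hcomp]
    refine hb.1.map ?_
    rw [hb.2, Submodule.disjoint_def]
    intro x hx hx0
    rw [← h.mulVec_mulVec_cancel hx]
    rw [LinearMap.mem_ker, mulVecLin_apply] at hx0
    rw [hx0, mulVec_zero]
  · rw [hcomp, Set.range_comp, Submodule.span_image, hb.2]
    refine le_antisymm (Submodule.map_le_iff_le_comap.mpr fun x hx => h.mulVec_mem hx) ?_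
    exact fun y hy => ⟨matRF Ψ *ᵥ y, h.symm.mulVec_mem hy, h.symm.mulVec_mulVec_cancel hy⟩

end NullEquiv

lemma IsPolyBasis.mulVec_eq_zero [Fintype γ] {P : Matrix ρ γ F[X]} {b : ι → γ → F[X]}
    (hb : IsPolyBasis (Nr P) b) (i : ι) : P *ᵥ b i = 0 := by
  rw [← polyVec_mem_Nr, ← hb.2]
  exact Submodule.subset_span ⟨i, rfl⟩

lemma IsPolyBasis.ne_zero [Fintype γ] {V : Submodule (RatFunc F) (γ → RatFunc F)}
    {b : ι → γ → F[X]} (hb : IsPolyBasis V b) (i : ι) : b i ≠ 0 := fun h =>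
  hb.1.ne_zero i (by simp only [h]; ext; simp [polyVec])

lemma IsPolyBasis.card_eq [Fintype γ] {V : Submodule (RatFunc F) (γ → RatFunc F)} [Fintype ι]
    {d : ℕ} {b : ι → γ → F[X]} {b' : Fin d → γ → F[X]} (hb : IsPolyBasis V b)
    (hb' : IsPolyBasis V b') : Fintype.card ι = d := by
  have h := finrank_span_eq_card hb.1
  have h' := finrank_span_eq_card hb'.1
  rw [hb.2] at h
  rw [hb'.2, Fintype.card_fin] at h'
  omega

/-- A null space isomorphism shifting degrees by a constant preserves minimal bases. -/
lemma NullEquiv.isMinimalBasis [Fintype ρ] [Fintype ρ'] [Fintype γ] [Fintype γ']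
    [DecidableEq γ] [DecidableEq γ'] {P : Matrix ρ γ F[X]} {N : Matrix ρ' γ' F[X]}
    {Φ : Matrix γ' γ F[X]} {Ψ : Matrix γ γ' F[X]} [Fintype ι] (h : NullEquiv P N Φ Ψ)
    {a c : ℕ} (hdeg : ∀ x : γ → F[X], P *ᵥ x = 0 → x ≠ 0 →
      polyVecDeg (Φ *ᵥ x) + a = polyVecDeg x + c)
    {b : ι → γ → F[X]} (hb : IsMinimalBasis (Nr P) b) :
    IsMinimalBasis (Nr N) fun i => Φ *ᵥ b i := by
  refine ⟨h.isPolyBasis hb.1, fun d b' hb' => ?_⟩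
  have hcard := (h.isPolyBasis hb.1).card_eq hb'
  have hΨ := h.symm.isPolyBasis hb'
  have hle := hb.2 d _ hΨ
  have h1 : ∑ i, (polyVecDeg (Φ *ᵥ b i) + a) = ∑ i, (polyVecDeg (b i) + c) :=
    Finset.sum_congr rfl fun i _ => hdeg _ (hb.1.mulVec_eq_zero i) (hb.1.ne_zero i)
  have h2 : ∑ i, (polyVecDeg (b' i) + a) = ∑ i, (polyVecDeg (Ψ *ᵥ b' i) + c) :=
    Finset.sum_congr rfl fun i _ => by
      rw [← hdeg _ (hΨ.mulVec_eq_zero i) (hΨ.ne_zero i),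
        h.symm.poly_cancel (hb'.mulVec_eq_zero i)]
  simp only [Finset.sum_add_distrib, Finset.sum_const, Finset.card_univ, Fintype.card_fin,
    hcard, smul_eq_mul] at h1 h2
  change ∑ i, polyVecDeg (Φ *ᵥ b i) ≤ _
  omega

lemma NullEquiv.degree_symm [Fintype ρ] [Fintype ρ'] [Fintype γ] [Fintype γ']
    [DecidableEq γ] [DecidableEq γ'] {P : Matrix ρ γ F[X]} {N : Matrix ρ' γ' F[X]}
    {Φ : Matrix γ' γ F[X]} {Ψ : Matrix γ γ' F[X]} (h : NullEquiv P N Φ Ψ)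
    {a c : ℕ} (hdeg : ∀ x : γ → F[X], P *ᵥ x = 0 → x ≠ 0 →
      polyVecDeg (Φ *ᵥ x) + a = polyVecDeg x + c) (y : γ' → F[X]) (hy : N *ᵥ y = 0)
    (hy0 : y ≠ 0) : polyVecDeg (Ψ *ᵥ y) + c = polyVecDeg y + a := by
  have hcancel := h.symm.poly_cancel hy
  rw [← hdeg _ (h.symm.mulVec_eq_zero hy), hcancel]
  intro h0
  rw [h0, mulVec_zero] at hcancel
  exact hy0 hcancel.symm

lemma NullEquiv.hasMinIndices_iff [Fintype ρ] [Fintype ρ'] [Fintype γ] [Fintype γ']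
    [DecidableEq γ] [DecidableEq γ'] {P : Matrix ρ γ F[X]} {N : Matrix ρ' γ' F[X]}
    {Φ : Matrix γ' γ F[X]} {Ψ : Matrix γ γ' F[X]} (h : NullEquiv P N Φ Ψ)
    {c : ℕ} (hdeg : ∀ x : γ → F[X], P *ᵥ x = 0 → x ≠ 0 →
      polyVecDeg (Φ *ᵥ x) = polyVecDeg x + c) {d : ℕ} (ε : Fin d → ℕ) :
    HasMinIndices (Nr P) ε ↔ HasMinIndices (Nr N) fun i => ε i + c := by
  have hdeg' : ∀ x : γ → F[X], P *ᵥ x = 0 → x ≠ 0 →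
    polyVecDeg (Φ *ᵥ x) + 0 = polyVecDeg x + c := hdeg
  constructor
  · rintro ⟨b, hb, hε⟩
    refine ⟨_, h.isMinimalBasis hdeg' hb, fun i => ?_⟩
    rw [hdeg _ (hb.1.mulVec_eq_zero i) (hb.1.ne_zero i), hε]
  · rintro ⟨b, hb, hε⟩
    refine ⟨_, h.symm.isMinimalBasis (h.degree_symm hdeg') hb, fun i => ?_⟩
    have := h.degree_symm hdeg' _ (hb.1.mulVec_eq_zero i) (hb.1.ne_zero i)
    have : polyVecDeg (b i) = ε i + c := hε i
    omega

end Transfer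

/-! ### Block-diagonalization data -/

section Data

variable {ρ γ μ ν σ : Type*} [Fintype ρ] [Fintype γ] [Fintype μ] [Fintype ν] [Fintype σ]
  [DecidableEq ρ] [DecidableEq γ] [DecidableEq μ] [DecidableEq ν] [DecidableEq σ]

/-- The blocks of an equivalence between `N` and `diag(P, 1)`: it is given by the mutually inverse
pairs `[Λ; U]`, `[e | N V]` and `[Φ | V]`, `[Ψ; U N]`. -/
structure DiagData (P : Matrix μ ν F[X]) (N : Matrix ρ γ F[X]) (Λ : Matrix μ ρ F[X])
    (e : Matrix ρ μ F[X]) (U : Matrix σ ρ F[X]) (V : Matrix γ σ F[X])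
    (Φ : Matrix γ ν F[X]) (Ψ : Matrix ν γ F[X]) : Prop where
  rowMul : Λ * N = P * Ψ
  mulCol : N * Φ = e * P
  rowCol : Λ * e = 1
  retract : Ψ * Φ = 1
  complRow : U * e = 0
  complCol : Ψ * V = 0
  complMid : U * N * V = 1
  rowSplit : e * Λ + N * V * U = 1
  colSplit : Φ * Ψ + V * U * N = 1

variable {P : Matrix μ ν F[X]} {N : Matrix ρ γ F[X]} {Λ : Matrix μ ρ F[X]}
  {e : Matrix ρ μ F[X]} {U : Matrix σ ρ F[X]} {V : Matrix γ σ F[X]}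
  {Φ : Matrix γ ν F[X]} {Ψ : Matrix ν γ F[X]}

lemma DiagData.nullEquiv_right (h : DiagData P N Λ e U V Φ Ψ) : NullEquiv P N Φ Ψ where
  map := ⟨e, h.mulCol⟩
  comap := ⟨Λ, h.rowMul.symm⟩
  left_inv := ⟨0, by rw [h.retract, Matrix.zero_mul, add_zero]⟩
  right_inv := ⟨V * U, h.colSplit⟩

lemma DiagData.nullEquiv_left (h : DiagData P N Λ e U V Φ Ψ) : NullEquiv Pᵀ Nᵀ Λᵀ eᵀ where
  map := ⟨Ψᵀ, by rw [← transpose_mul, h.rowMul, transpose_mul]⟩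
  comap := ⟨Φᵀ, by rw [← transpose_mul, ← h.mulCol, transpose_mul]⟩
  left_inv := ⟨0, by rw [← transpose_mul, h.rowCol, Matrix.zero_mul, add_zero, transpose_one]⟩
  right_inv := ⟨(V * U)ᵀ, by
    rw [← transpose_mul, ← transpose_mul, ← transpose_add, ← Matrix.mul_assoc, h.rowSplit,
      transpose_one]⟩

lemma mul_mul_cancel {R τ : Type*} [CommRing R] {S S' : Matrix γ γ R} (hS : S * S' = 1)
    (C : Matrix γ τ R) : S * (S' * C) = C := by
  rw [← Matrix.mul_assoc, hS, Matrix.one_mul]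

/-- Data for `[B | K] S` built from a splitting of the rows adapted to `K`. -/
lemma DiagData.mk_of_split {K : Matrix ρ σ F[X]} {B : Matrix ρ ν F[X]}
    {S S' : Matrix (ν ⊕ σ) (ν ⊕ σ) F[X]} (hΛK : Λ * K = 0) (hΛe : Λ * e = 1)
    (hUe : U * e = 0) (hUK : U * K = 1) (hsplit : e * Λ + K * U = 1) (hB : Λ * B = P)
    (hS : S * S' = 1) :
    DiagData P (fromCols B K * S) Λ e U
      (S' * (fromRows 0 1 : Matrix (ν ⊕ σ) σ F[X]))
      (S' * (fromRows 1 (-(U * B)) : Matrix (ν ⊕ σ) ν F[X]))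
      ((fromCols 1 0 : Matrix ν (ν ⊕ σ) F[X]) * S) := by
  have hS' : S' * S = 1 := mul_eq_one_comm.mp hS
  have hBe : B - K * (U * B) = e * P := by
    have := congrArg (· * B) hsplit
    simp only [Matrix.add_mul, Matrix.one_mul, Matrix.mul_assoc, hB] at this
    exact sub_eq_of_eq_add this.symm
  refine ⟨?_, ?_, hΛe, ?_, hUe, ?_, ?_, ?_, ?_⟩
  · rw [← Matrix.mul_assoc, ← Matrix.mul_assoc, mul_fromCols, mul_fromCols, hB, hΛK,
      Matrix.mul_one, Matrix.mul_zero]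
  · rw [Matrix.mul_assoc, mul_mul_cancel hS, fromCols_mul_fromRows, Matrix.mul_one, Matrix.mul_neg,
      ← sub_eq_add_neg, hBe]
  · rw [Matrix.mul_assoc, mul_mul_cancel hS, fromCols_mul_fromRows]; simp
  · rw [Matrix.mul_assoc, mul_mul_cancel hS, fromCols_mul_fromRows]; simp
  · rw [Matrix.mul_assoc, Matrix.mul_assoc, mul_mul_cancel hS, fromCols_mul_fromRows]; simp [hUK]
  · rw [Matrix.mul_assoc (fromCols B K), mul_mul_cancel hS, fromCols_mul_fromRows]; simpa using hsplit
  · have : (fromRows 1 (-(U * B)) : Matrix (ν ⊕ σ) ν F[X]) *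
        (fromCols 1 0 : Matrix ν (ν ⊕ σ) F[X]) +
        (fromRows 0 1 : Matrix (ν ⊕ σ) σ F[X]) * U * fromCols B K = 1 := by
      rw [Matrix.mul_assoc, mul_fromCols U B K, hUK, fromRows_mul_fromCols, fromRows_mul_fromCols,
        fromBlocks_add]
      simp
    calc _ = S' * ((fromRows 1 (-(U * B)) : Matrix (ν ⊕ σ) ν F[X]) *
        (fromCols 1 0 : Matrix ν (ν ⊕ σ) F[X]) +
        (fromRows 0 1 : Matrix (ν ⊕ σ) σ F[X]) * U * fromCols B K) * S := by
          simp only [Matrix.mul_add, Matrix.add_mul, Matrix.mul_assoc]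
      _ = 1 := by rw [this, Matrix.mul_one, hS']

lemma DiagData.isLin {m n s : ℕ} {P : Matrix (Fin m) (Fin n) F[X]} {Λ : Matrix (Fin m) ρ F[X]}
    {e : Matrix ρ (Fin m) F[X]} {Φ : Matrix γ (Fin n) F[X]} {Ψ : Matrix (Fin n) γ F[X]}
    (h : DiagData P N Λ e U V Φ Ψ) (er : ρ ≃ Fin m ⊕ Fin s) (ec : γ ≃ Fin n ⊕ Fin s)
    (es : σ ≃ Fin s) : IsLin s P N := by
  have hE : fromRows Λ U * fromCols e (N * V) = 1 := by
    rw [fromRows_mul_fromCols, h.rowCol, h.complRow, ← Matrix.mul_assoc, ← Matrix.mul_assoc,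
      h.rowMul, Matrix.mul_assoc P, h.complCol, Matrix.mul_zero, h.complMid, fromBlocks_one]
  have hG : fromRows Ψ (U * N) * fromCols Φ V = 1 := by
    rw [fromRows_mul_fromCols, h.retract, h.complCol, h.complMid, Matrix.mul_assoc, h.mulCol,
      ← Matrix.mul_assoc, h.complRow, Matrix.zero_mul, fromBlocks_one]
  have hENG : fromRows Λ U * N * fromCols Φ V = fromBlocks P 0 0 1 := by
    rw [fromRows_mul, fromRows_mul_fromCols, h.rowMul, Matrix.mul_assoc, h.retract,
      Matrix.mul_assoc P, h.complCol, h.complMid, Matrix.mul_assoc, h.mulCol,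
      ← Matrix.mul_assoc, h.complRow, Matrix.zero_mul, Matrix.mul_zero, Matrix.mul_one]
  let fm := Equiv.sumCongr (Equiv.refl (Fin m)) es
  let fn := Equiv.sumCongr (Equiv.refl (Fin n)) es
  refine ⟨er, ec, reindex fm er (fromRows Λ U), reindex ec fn (fromCols Φ V), ?_, ?_, ?_⟩
  · refine IsUnit.of_mul_eq_one (reindex er fm (fromCols e (N * V))).det ?_
    rw [← det_mul]
    simp only [reindex_apply, submatrix_mul_equiv, hE, submatrix_one_equiv, det_one]
  · refine IsUnit.of_mul_eq_one_right (reindex fn ec (fromRows Ψ (U * N))).det ?_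
    rw [← det_mul]
    simp only [reindex_apply, submatrix_mul_equiv, hG, submatrix_one_equiv, det_one]
  · simp only [reindex_apply, submatrix_mul_equiv, hENG]
    ext i j
    rcases i with i | i <;> rcases j with j | j <;>
      simp [fm, fn, Matrix.one_apply]

end Data

/-! ### Selection matrices and the pencil annihilated by `Λ` -/

section Selection

variable {ρ γ σ R : Type*} [DecidableEq ρ] [CommRing R]

/-- The matrix whose columns are the standard basis vectors indexed by `f`. -/
def sel (R : Type*) [CommRing R] (f : σ → ρ) : Matrix ρ σ R :=
  Matrix.of fun p j => if p = f j then 1 else 0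

lemma mul_sel [Fintype ρ] (N : Matrix γ ρ R) (f : σ → ρ) : N * sel R f = N.submatrix id f := by
  ext i j
  simp [mul_apply, sel]

lemma sel_transpose_mul [Fintype ρ] (f : σ → ρ) (N : Matrix ρ γ R) :
    (sel R f)ᵀ * N = N.submatrix f id := by
  ext i j
  simp [mul_apply, sel]

lemma sel_mul_apply [Fintype σ] {f : σ → ρ} (hf : Function.Injective f) (N : Matrix σ γ R)
    (j : σ) (c : γ) : (sel R f * N) (f j) c = N j c := by
  classical
  simp [mul_apply, sel, hf.eq_iff]

lemma sel_mul_apply_of_ne [Fintype σ] {f : σ → ρ} {p : ρ} (hp : ∀ j, p ≠ f j)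
    (N : Matrix σ γ R) (c : γ) : (sel R f * N) p c = 0 := by
  simp [mul_apply, sel, hp]

end Selection

section Index

variable {k m : ℕ}

/-- The block index `(j, a)` of a `k`-fold product coming from a `(k-1)`-fold one. -/
def lo (j : Fin (k - 1) × Fin m) : Fin k × Fin m := (⟨j.1, by have := j.1.isLt; omega⟩, j.2)

/-- The block index `(j + 1, a)` of a `k`-fold product coming from a `(k-1)`-fold one. -/
def hi (j : Fin (k - 1) × Fin m) : Fin k × Fin m :=
  (⟨j.1 + 1, by have := j.1.isLt; omega⟩, j.2)

/-- The indices of the first block. -/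
def fstBlock (hk : 0 < k) (a : Fin m) : Fin k × Fin m := (⟨0, hk⟩, a)

/-- The indices of the last block. -/
def lastBlock (hk : 0 < k) (a : Fin m) : Fin k × Fin m := (⟨k - 1, by omega⟩, a)

lemma lo_injective : Function.Injective (lo : Fin (k - 1) × Fin m → Fin k × Fin m) := by
  rintro ⟨i, a⟩ ⟨j, b⟩ h
  simpa [lo, Fin.ext_iff] using h

lemma hi_injective : Function.Injective (hi : Fin (k - 1) × Fin m → Fin k × Fin m) := by
  rintro ⟨i, a⟩ ⟨j, b⟩ h
  simpa [hi, Fin.ext_iff] using h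

lemma eq_fstBlock_or_eq_hi (hk : 0 < k) (p : Fin k × Fin m) :
    p = fstBlock hk p.2 ∨ ∃ j, p = hi j := by
  obtain ⟨⟨i, hi'⟩, a⟩ := p
  rcases i with _ | i
  · exact Or.inl rfl
  · exact Or.inr ⟨(⟨i, by omega⟩, a), rfl⟩

lemma eq_lastBlock_or_eq_lo (hk : 0 < k) (p : Fin k × Fin m) :
    p = lastBlock hk p.2 ∨ ∃ j, p = lo j := by
  obtain ⟨⟨i, hi'⟩, a⟩ := p
  by_cases h : i = k - 1
  · exact Or.inl (by simp [lastBlock, h])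
  · exact Or.inr ⟨(⟨i, by omega⟩, a), rfl⟩

lemma fstBlock_ne_hi (hk : 0 < k) (a : Fin m) (j : Fin (k - 1) × Fin m) :
    fstBlock hk a ≠ hi j := by
  simp [fstBlock, hi]

lemma lastBlock_ne_lo (hk : 0 < k) (a : Fin m) (j : Fin (k - 1) × Fin m) :
    lastBlock hk a ≠ lo j := by
  have := j.1.isLt
  simp [lastBlock, lo]
  omega

end Index

section Annihilated

variable {k m : ℕ} {γ : Type*}

/-- The `λ`-coefficient of the pencil spanning the annihilator of `Λ_kᵀ ⊗ I_m`. -/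
def KX (F : Type*) [RCLike F] (k m : ℕ) : Matrix (Fin k × Fin m) (Fin (k - 1) × Fin m) F :=
  -sel F hi

/-- The constant coefficient of the pencil spanning the annihilator of `Λ_kᵀ ⊗ I_m`. -/
def KY (F : Type*) [RCLike F] (k m : ℕ) : Matrix (Fin k × Fin m) (Fin (k - 1) × Fin m) F :=
  sel F lo

/-- The left inverse of `λ KX + KY` supported on all but the last block column. -/
def KInv (F : Type*) [RCLike F] (k m : ℕ) :
    Matrix (Fin (k - 1) × Fin m) (Fin k × Fin m) F[X] :=
  Matrix.of fun i p =>
    if i.2 = p.2 ∧ (p.1 : ℕ) ≤ i.1 then X ^ ((i.1 : ℕ) - p.1) else 0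

/-- The left inverse of `λ KY + KX` supported on all but the first block column. -/
def KRevInv (F : Type*) [RCLike F] (k m : ℕ) :
    Matrix (Fin (k - 1) × Fin m) (Fin k × Fin m) F[X] :=
  Matrix.of fun i p =>
    if i.2 = p.2 ∧ (i.1 : ℕ) < p.1 then -X ^ ((p.1 : ℕ) - i.1 - 1) else 0

/-- `(1, λ, …, λ^{k-1}) ⊗ I_m`. -/
def LamRevRow (F : Type*) [RCLike F] (k m : ℕ) : Matrix (Fin m) (Fin k × Fin m) F[X] :=
  Matrix.of fun r p => if r = p.2 then X ^ (p.1 : ℕ) else 0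

lemma mul_pencil_KX_KY (N : Matrix γ (Fin k × Fin m) F[X]) (i : γ) (j : Fin (k - 1) × Fin m) :
    (N * pencil (KX F k m) (KY F k m)) i j = N i (lo j) - N i (hi j) * X := by
  have h (p : Fin k × Fin m) : pencil (KX F k m) (KY F k m) p j =
      (if p = lo j then 1 else 0) - (if p = hi j then X else 0) := by
    simp only [pencil, KX, KY, sel, of_apply, Matrix.neg_apply]
    split_ifs <;> simp [sub_eq_add_neg, add_comm]
  simp [mul_apply, h, mul_sub, Finset.sum_sub_distrib]

lemma mul_pencil_KY_KX (N : Matrix γ (Fin k × Fin m) F[X]) (i : γ) (j : Fin (k - 1) × Fin m) :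
    (N * pencil (KY F k m) (KX F k m)) i j = N i (lo j) * X - N i (hi j) := by
  have h (p : Fin k × Fin m) : pencil (KY F k m) (KX F k m) p j =
      (if p = lo j then X else 0) - (if p = hi j then 1 else 0) := by
    simp only [pencil, KX, KY, sel, of_apply, Matrix.neg_apply]
    split_ifs <;> simp [sub_eq_add_neg, add_comm]
  simp [mul_apply, h, mul_sub, Finset.sum_sub_distrib]

lemma LamRow_mul_pencil_K : LamRow F k m * pencil (KX F k m) (KY F k m) = 0 := by
  ext1 a ⟨j, b⟩
  rw [mul_pencil_KX_KY]
  have := j.isLt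
  by_cases h : a = b
  · simp only [LamRow, of_apply, lo, hi, h, if_true, Matrix.zero_apply, ← pow_succ]
    rw [sub_eq_zero]
    congr 1
    omega
  · simp [LamRow, lo, hi, h]

lemma LamRevRow_mul_pencil_K : LamRevRow F k m * pencil (KY F k m) (KX F k m) = 0 := by
  ext1 a ⟨j, b⟩
  rw [mul_pencil_KY_KX]
  by_cases h : a = b
  · simp [LamRevRow, lo, hi, h, pow_succ]
  · simp [LamRevRow, lo, hi, h]

lemma LamRow_mul_sel (hk : 0 < k) : LamRow F k m * sel F[X] (lastBlock (m := m) hk) = 1 := by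
  ext1 a b
  rw [mul_sel]
  simp [LamRow, lastBlock, one_apply]

lemma LamRevRow_mul_sel (hk : 0 < k) : LamRevRow F k m * sel F[X] (fstBlock (m := m) hk) = 1 := by
  ext1 a b
  rw [mul_sel]
  simp [LamRevRow, fstBlock, one_apply]

lemma KInv_mul_sel (hk : 0 < k) : KInv F k m * sel F[X] (lastBlock (m := m) hk) = 0 := by
  ext1 ⟨i, a⟩ b
  rw [mul_sel]
  have := i.isLt
  simp [KInv, lastBlock]
  omega

lemma KRevInv_mul_sel (hk : 0 < k) : KRevInv F k m * sel F[X] (fstBlock (m := m) hk) = 0 := by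
  ext1 i b
  rw [mul_sel]
  simp [KRevInv, fstBlock]

lemma KInv_mul_pencil_K : KInv F k m * pencil (KX F k m) (KY F k m) = 1 := by
  ext1 ⟨i, a⟩ ⟨j, b⟩
  rw [mul_pencil_KX_KY, one_apply]
  by_cases h : a = b
  · rcases lt_trichotomy (i : ℕ) j with hij | hij | hij
    · have h1 : ¬ (j : ℕ) ≤ i := by omega
      have h2 : ¬ (j : ℕ) + 1 ≤ i := by omega
      have h3 : i ≠ j := fun e => by simp [e] at hij
      simp [KInv, lo, hi, h1, h2, h3]
    · have h3 : i = j := Fin.ext hij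
      simp [KInv, lo, hi, h3, h]
    · have h1 : (j : ℕ) ≤ i := by omega
      have h2 : (j : ℕ) + 1 ≤ i := by omega
      have h3 : i ≠ j := fun e => by simp [e] at hij
      simp only [KInv, lo, hi, of_apply, h, h1, h2, h3, true_and, if_true, Prod.mk.injEq,
        false_and, if_false, ← pow_succ]
      rw [sub_eq_zero]
      congr 1
      omega
  · simp [KInv, lo, hi, h]

lemma KRevInv_mul_pencil_K : KRevInv F k m * pencil (KY F k m) (KX F k m) = 1 := by
  ext1 ⟨i, a⟩ ⟨j, b⟩
  rw [mul_pencil_KY_KX, one_apply]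
  by_cases h : a = b
  · rcases lt_trichotomy (i : ℕ) j with hij | hij | hij
    · have h2 : (i : ℕ) < j + 1 := by omega
      have h3 : i ≠ j := fun e => by simp [e] at hij
      simp only [KRevInv, lo, hi, of_apply, h, hij, h2, h3, true_and, if_true, Prod.mk.injEq,
        false_and, if_false, neg_mul, ← pow_succ]
      rw [sub_eq_zero]
      congr 2
      omega
    · have h3 : i = j := Fin.ext hij
      simp [KRevInv, lo, hi, h3, h]
    · have h1 : ¬ (i : ℕ) < j := by omega
      have h2 : ¬ (i : ℕ) < j + 1 := by omega
      have h3 : i ≠ j := fun e => by simp [e] at hij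
      simp [KRevInv, lo, hi, h1, h2, h3]
  · simp [KRevInv, lo, hi, h]

/-- Splitting off one block of indices. -/
def blockEquiv (hk : 0 < k) : Fin k × Fin m ≃ Fin m ⊕ (Fin (k - 1) × Fin m) :=
  Fintype.equivOfCardEq (by
    obtain ⟨k, rfl⟩ := Nat.exists_eq_succ_of_ne_zero hk.ne'
    simp
    ring)

lemma split_of_mul_eq_one {σ μ ρ : Type*} [Fintype ρ] [Fintype μ] [Fintype σ] [DecidableEq ρ]
    [DecidableEq μ] [DecidableEq σ] {R : Type*} [CommRing R] (eq : ρ ≃ μ ⊕ σ)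
    {Λ : Matrix μ ρ R} {e : Matrix ρ μ R} {U : Matrix σ ρ R} {K : Matrix ρ σ R}
    (hΛK : Λ * K = 0) (hΛe : Λ * e = 1) (hUe : U * e = 0) (hUK : U * K = 1) :
    e * Λ + K * U = 1 := by
  rw [← fromCols_mul_fromRows, fromCols_mul_fromRows_eq_one_comm eq, fromRows_mul_fromCols,
    hΛK, hΛe, hUe, hUK, fromBlocks_one]

end Annihilated

/-! ### Pencils, ansatz identities and reversals -/

section Pencil

variable {k m n : ℕ} {ρ γ δ : Type*}

lemma pencil_mul [Fintype γ] (Xc Yc : Matrix ρ γ F) (D : Matrix γ δ F) :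
    pencil (Xc * D) (Yc * D) = pencil Xc Yc * D.map C := by
  ext1 i j
  simp only [pencil, of_apply, mul_apply, map_apply, map_sum, map_mul, add_mul,
    Finset.sum_add_distrib, Finset.sum_mul, mul_right_comm]

lemma pencil_fromCols (X₁ Y₁ : Matrix ρ γ F) (X₂ Y₂ : Matrix ρ δ F) :
    pencil (fromCols X₁ X₂) (fromCols Y₁ Y₂) = fromCols (pencil X₁ Y₁) (pencil X₂ Y₂) := by
  ext1 i (j | j) <;> rfl

lemma revMat_pencil (Xc Yc : Matrix ρ γ F) : revMat 1 (pencil Xc Yc) = pencil Yc Xc := by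
  ext1 i j
  simp only [revMat, pencil, map_apply, of_apply, reflect_add, reflect_C_mul, reflect_one_X,
    reflect_C, pow_one, mul_one]
  ring

lemma reflect_sum {ι : Type*} (N : ℕ) (s : Finset ι) (f : ι → F[X]) :
    reflect N (∑ i ∈ s, f i) = ∑ i ∈ s, reflect N (f i) :=
  map_sum (AddMonoidHom.mk' (reflect N) fun p q => reflect_add p q N) f s

lemma LamRow_mul_apply (N : Matrix (Fin k × Fin m) γ F[X]) (a : Fin m) (c : γ) :
    (LamRow F k m * N) a c = ∑ p : Fin k, X ^ (k - 1 - (p : ℕ)) * N (p, a) c := by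
  simp [mul_apply, LamRow, Fintype.sum_prod_type]

lemma LamRevRow_mul_apply (N : Matrix (Fin k × Fin m) γ F[X]) (a : Fin m) (c : γ) :
    (LamRevRow F k m * N) a c = ∑ p : Fin k, X ^ (p : ℕ) * N (p, a) c := by
  simp [mul_apply, LamRevRow, Fintype.sum_prod_type]

lemma reflect_X_pow_mul_linear {p : ℕ} (hp : p < k) (a b : F) :
    reflect k (X ^ (k - 1 - p) * (C a * X + C b)) = X ^ p * (C b * X + C a) := by
  have h : X ^ (k - 1 - p) * (C a * X + C b) =
      C a * X ^ (k - 1 - p + 1) + C b * X ^ (k - 1 - p) := by ring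
  rw [h, reflect_add, reflect_C_mul_X_pow, reflect_C_mul_X_pow, revAt_le (by omega),
    revAt_le (by omega), show k - (k - 1 - p + 1) = p by omega,
    show k - (k - 1 - p) = p + 1 by omega]
  ring

lemma revMat_LamRow_mul_pencil (Xc Yc : Matrix (Fin k × Fin m) γ F) :
    revMat k (LamRow F k m * pencil Xc Yc) = LamRevRow F k m * pencil Yc Xc := by
  ext1 a c
  rw [revMat, map_apply, LamRow_mul_apply, LamRevRow_mul_apply, reflect_sum]
  exact Finset.sum_congr rfl fun p _ => reflect_X_pow_mul_linear p.isLt _ _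

lemma coeff_X_pow_mul_linear (s t : ℕ) (a b : F) :
    (X ^ s * (C a * X + C b)).coeff t = (if t = s + 1 then a else 0) + if t = s then b else 0 := by
  have h : X ^ s * (C a * X + C b) = C a * X ^ (s + 1) + C b * X ^ s := by ring
  rw [h, coeff_add, coeff_C_mul_X_pow, coeff_C_mul_X_pow]

/-- A pencil annihilated by `Λ_kᵀ ⊗ I_m` is a right multiple of `λ KX + KY`. -/
lemma eq_K_mul_of_LamRow_mul_eq_zero (hk : 0 < k) {X₂ Y₂ : Matrix (Fin k × Fin m) γ F}
    (h : LamRow F k m * pencil X₂ Y₂ = 0) :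
    X₂ = KX F k m * Y₂.submatrix lo id ∧ Y₂ = KY F k m * Y₂.submatrix lo id := by
  have hc (a : Fin m) (c : γ) (t : ℕ) :
      (∑ p : Fin k, if t = k - 1 - (p : ℕ) + 1 then X₂ (p, a) c else 0) +
        (∑ p : Fin k, if t = k - 1 - (p : ℕ) then Y₂ (p, a) c else 0) = 0 := by
    have := congrArg (coeff · t) (congrFun₂ h a c)
    rw [LamRow_mul_apply] at this
    simpa only [pencil, of_apply, finsetSum_coeff, coeff_X_pow_mul_linear, Matrix.zero_apply,
      coeff_zero, Finset.sum_add_distrib] using this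
  constructor
  · ext p c
    rcases eq_fstBlock_or_eq_hi hk p with hp | ⟨j, rfl⟩
    · rw [hp, KX, Matrix.neg_mul, Matrix.neg_apply, sel_mul_apply_of_ne (fstBlock_ne_hi hk _),
        neg_zero]
      have := hc p.2 c k
      rw [Finset.sum_eq_single ⟨0, hk⟩, Finset.sum_eq_zero, if_pos (by simp; omega),
        add_zero] at this
      · exact this
      · exact fun q _ => if_neg (by omega)
      · intro q _ hq
        have : (q : ℕ) ≠ 0 := fun h => hq (Fin.ext h)
        exact if_neg (by omega)
      · simp
    · rw [KX, Matrix.neg_mul, Matrix.neg_apply, sel_mul_apply hi_injective]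
      have hj := j.1.isLt
      have := hc j.2 c (k - 1 - j.1)
      rw [Finset.sum_eq_single (hi j).1, Finset.sum_eq_single (lo j).1,
        if_pos (by simp [hi]; omega), if_pos (by simp [lo])] at this
      · exact eq_neg_of_add_eq_zero_left this
      · intro q _ hq
        have : (q : ℕ) ≠ j.1 := fun h => hq (Fin.ext h)
        exact if_neg (by omega)
      · simp
      · intro q _ hq
        have : (q : ℕ) ≠ j.1 + 1 := fun h => hq (Fin.ext h)
        exact if_neg (by omega)
      · simp
  · ext p c
    rcases eq_lastBlock_or_eq_lo hk p with hp | ⟨j, rfl⟩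
    · rw [hp, KY, sel_mul_apply_of_ne (lastBlock_ne_lo hk _)]
      have := hc p.2 c 0
      rw [Finset.sum_eq_zero (fun q _ => if_neg (by omega)),
        Finset.sum_eq_single ⟨k - 1, by omega⟩, if_pos (by simp), zero_add] at this
      · exact this
      · intro q _ hq
        have : (q : ℕ) ≠ k - 1 := fun h => hq (Fin.ext h)
        exact if_neg (by omega)
      · simp
    · rw [KY, sel_mul_apply lo_injective]
      rfl

end Pencil

/-! ### Degrees -/

section Degree

variable {k m n : ℕ} {ρ γ δ : Type*}

lemma polyVecDeg_le_iff [Fintype γ] {x : γ → F[X]} {d : ℕ} :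
    polyVecDeg x ≤ d ↔ ∀ i, (x i).natDegree ≤ d := by
  simp [polyVecDeg]

lemma natDegree_le_polyVecDeg [Fintype γ] (x : γ → F[X]) (i : γ) :
    (x i).natDegree ≤ polyVecDeg x :=
  polyVecDeg_le_iff.mp le_rfl i

lemma polyVecDeg_const_mulVec_le [Fintype γ] [Fintype δ] (S : Matrix γ δ F) (x : δ → F[X]) :
    polyVecDeg (S.map C *ᵥ x) ≤ polyVecDeg x :=
  polyVecDeg_le_iff.mpr fun _ => natDegree_sum_le_of_forall_le _ _ fun j _ =>
    (natDegree_C_mul_le _ _).trans (natDegree_le_polyVecDeg x j)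

lemma natDegree_pencil_mulVec_le [Fintype γ] (Xc Yc : Matrix ρ γ F) (x : γ → F[X]) (i : ρ) :
    ((pencil Xc Yc *ᵥ x) i).natDegree ≤ polyVecDeg x + 1 :=
  natDegree_sum_le_of_forall_le _ _ fun j _ => by
    change (pencil Xc Yc i j * x j).natDegree ≤ _
    refine natDegree_mul_le.trans ?_
    have := natDegree_le_polyVecDeg x j
    have : (pencil Xc Yc i j).natDegree ≤ 1 := natDegree_linear_le
    omega

lemma LamRow_transpose_mulVec (x : Fin m → F[X]) :
    (LamRow F k m)ᵀ *ᵥ x = fun p => X ^ (k - 1 - (p.1 : ℕ)) * x p.2 := by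
  ext1 p
  simp [mulVec, dotProduct, LamRow]

lemma polyVecDeg_LamRow_transpose_mulVec (hk : 0 < k) {x : Fin m → F[X]} (hx : x ≠ 0) :
    polyVecDeg ((LamRow F k m)ᵀ *ᵥ x) = polyVecDeg x + (k - 1) := by
  rw [LamRow_transpose_mulVec]
  refine le_antisymm (polyVecDeg_le_iff.mpr fun p => ?_) ?_
  · refine natDegree_mul_le.trans ?_
    rw [natDegree_X_pow]
    have := natDegree_le_polyVecDeg x p.2
    omega
  · have hle (a : Fin m) (ha : x a ≠ 0) : (x a).natDegree + (k - 1) ≤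
        polyVecDeg fun p : Fin k × Fin m => X ^ (k - 1 - (p.1 : ℕ)) * x p.2 := by
      refine le_trans ?_ (natDegree_le_polyVecDeg _ (fstBlock hk a))
      simp only [fstBlock, Nat.sub_zero]
      rw [natDegree_X_pow_mul _ ha]
    obtain ⟨a₀, ha₀⟩ := Function.ne_iff.mp hx
    rw [← Nat.le_sub_iff_add_le ((Nat.le_add_left _ _).trans (hle a₀ ha₀)), polyVecDeg_le_iff]
    intro a
    by_cases ha : x a = 0
    · simp [ha]
    · exact Nat.le_sub_of_add_le (hle a ha)

lemma pencil_K_mulVec_hi (u : Fin (k - 1) × Fin m → F[X]) (j : Fin (k - 1) × Fin m) :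
    (pencil (KX F k m) (KY F k m) *ᵥ u) (hi j) =
      (if h : (j.1 : ℕ) + 1 < k - 1 then u (⟨j.1 + 1, h⟩, j.2) else 0) - X * u j := by
  have hK (i : Fin (k - 1) × Fin m) : pencil (KX F k m) (KY F k m) (hi j) i =
      (if hi j = lo i then 1 else 0) - (if j = i then X else 0) := by
    simp only [pencil, KX, KY, sel, of_apply, Matrix.neg_apply, hi_injective.eq_iff]
    split_ifs <;> simp [sub_eq_add_neg, add_comm]
  simp only [mulVec, dotProduct, hK, sub_mul, Finset.sum_sub_distrib, ite_mul, zero_mul,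
    one_mul, Finset.sum_ite_eq, Finset.mem_univ, if_true]
  congr 1
  split_ifs with h
  · have hh : hi j = lo (⟨j.1 + 1, h⟩, j.2) := rfl
    simp only [hh, lo_injective.eq_iff, Finset.sum_ite_eq, Finset.mem_univ, if_true]
  · refine Finset.sum_eq_zero fun i _ => if_neg fun hij => h ?_
    have := congrArg (fun p => (p.1 : ℕ)) hij
    simp only [hi, lo] at this
    have := i.1.isLt
    omega

lemma polyVecDeg_le_of_pencil_K_mulVec {u : Fin (k - 1) × Fin m → F[X]} {d : ℕ}
    (h : ∀ p, ((pencil (KX F k m) (KY F k m) *ᵥ u) p).natDegree ≤ d + 1) :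
    polyVecDeg u ≤ d := by
  rw [polyVecDeg_le_iff]
  suffices ∀ t (j : Fin (k - 1) × Fin m), k - 1 - (j.1 : ℕ) = t → (u j).natDegree ≤ d from
    fun j => this _ j rfl
  intro t
  induction t with
  | zero => intro j hj; have := j.1.isLt; omega
  | succ t ih =>
    intro j hj
    by_cases h0 : u j = 0
    · simp [h0]
    have hrow := pencil_K_mulVec_hi u j
    have hX : X * u j = (if h : (j.1 : ℕ) + 1 < k - 1 then u (⟨j.1 + 1, h⟩, j.2) else 0) -
        (pencil (KX F k m) (KY F k m) *ᵥ u) (hi j) := by rw [hrow]; ring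
    have hdeg : (X * u j).natDegree ≤ d + 1 := by
      rw [hX]
      refine (natDegree_sub_le _ _).trans (max_le ?_ (h _))
      split_ifs with hlt
      · refine (ih _ ?_).trans (Nat.le_succ d)
        simp only
        omega
      · simp
    rw [natDegree_X_mul h0] at hdeg
    omega

end Degree

/-! ### Trimming -/

section Trim

variable {γ ν μ σ τ ρ : Type*} [Fintype γ] [Fintype ν] [Fintype μ] [Fintype σ] [Fintype τ]
  [DecidableEq γ] [DecidableEq μ]

lemma trim_mul_eq_one [DecidableEq ν] [DecidableEq σ] {G₀ : Matrix γ ν F}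
    {Gₕ : Matrix γ μ F} {H₀ : Matrix ν γ F} {Hₕ : Matrix μ γ F} (h₀₀ : H₀ * G₀ = 1) (h₀ₕ : H₀ * Gₕ = 0) (hₕ₀ : Hₕ * G₀ = 0)
    (hₕₕ : Hₕ * Gₕ = 1) {Q₁ : Matrix μ σ F} {Q₂ : Matrix μ τ F} (h₁₁ : Q₁ᴴ * Q₁ = 1)
    (h₁₂ : Q₁ᴴ * Q₂ = 0) {D : Matrix γ (ν ⊕ σ) F} {B₁ : Matrix (ν ⊕ σ) γ F}
    {B₂ : Matrix τ γ F} (hD : D * B₁ + Gₕ * Q₂ * B₂ = 1) :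
    (fromRows H₀ (Q₁ᴴ * Hₕ) * D) * (B₁ * fromCols G₀ (Gₕ * Q₁)) = 1 := by
  have hDB : D * B₁ = 1 - Gₕ * Q₂ * B₂ := eq_sub_of_add_eq hD
  have h1 : H₀ * (D * B₁) = H₀ := by
    rw [hDB, Matrix.mul_sub, Matrix.mul_one, ← Matrix.mul_assoc, ← Matrix.mul_assoc, h₀ₕ]
    simp
  have h2 : Q₁ᴴ * Hₕ * (D * B₁) = Q₁ᴴ * Hₕ := by
    have : Q₁ᴴ * Hₕ * (Gₕ * Q₂ * B₂) = 0 := by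
      calc _ = Q₁ᴴ * (Hₕ * Gₕ) * Q₂ * B₂ := by simp only [Matrix.mul_assoc]
        _ = 0 := by rw [hₕₕ, Matrix.mul_one, h₁₂, Matrix.zero_mul]
    rw [hDB, Matrix.mul_sub, Matrix.mul_one, this, sub_zero]
  have h3 : Q₁ᴴ * Hₕ * (Gₕ * Q₁) = 1 := by
    calc _ = Q₁ᴴ * (Hₕ * Gₕ) * Q₁ := by simp only [Matrix.mul_assoc]
      _ = 1 := by rw [hₕₕ, Matrix.mul_one, h₁₁]
  rw [Matrix.mul_assoc, ← Matrix.mul_assoc D, ← Matrix.mul_assoc, fromRows_mul, h1, h2,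
    fromRows_mul_fromCols, h₀₀, ← Matrix.mul_assoc H₀, h₀ₕ, Matrix.zero_mul,
    Matrix.mul_assoc _ Hₕ, hₕ₀, Matrix.mul_zero, h3, fromBlocks_one]

lemma trim_decompose {G₀ : Matrix γ ν F} {Gₕ : Matrix γ μ F} {H₀ : Matrix ν γ F}
    {Hₕ : Matrix μ γ F} (hG : G₀ * H₀ + Gₕ * Hₕ = 1) {Q₁ : Matrix μ σ F} {Q₂ : Matrix μ τ F}
    (hQ : Q₁ * Q₁ᴴ + Q₂ * Q₂ᴴ = 1) (D : Matrix γ (ν ⊕ σ) F) :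
    D = fromCols G₀ (Gₕ * Q₁) * (fromRows H₀ (Q₁ᴴ * Hₕ) * D) +
      Gₕ * Q₂ * (Q₂ᴴ * Hₕ * D) := by
  rw [← Matrix.mul_assoc, fromCols_mul_fromRows,
    ← Matrix.mul_assoc (Gₕ * Q₂) (Q₂ᴴ * Hₕ) D, ← Matrix.add_mul]
  have : G₀ * H₀ + Gₕ * Q₁ * (Q₁ᴴ * Hₕ) + Gₕ * Q₂ * (Q₂ᴴ * Hₕ) = 1 := by
    calc _ = G₀ * H₀ + Gₕ * (Q₁ * Q₁ᴴ + Q₂ * Q₂ᴴ) * Hₕ := by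
          simp only [Matrix.mul_add, Matrix.add_mul, Matrix.mul_assoc, add_assoc]
      _ = 1 := by rw [hQ, Matrix.mul_one, hG]
  rw [this, Matrix.one_mul]

lemma mul_trim_eq [DecidableEq ν] [DecidableEq σ] {G₀ : Matrix γ ν F}
    {Gₕ : Matrix γ μ F} {H₀ : Matrix ν γ F} {Hₕ : Matrix μ γ F} (hG : G₀ * H₀ + Gₕ * Hₕ = 1) {Q₁ : Matrix μ σ F} {Q₂ : Matrix μ τ F}
    (h₁₁ : Q₁ᴴ * Q₁ = 1) (h₁₂ : Q₁ᴴ * Q₂ = 0) (hQ : Q₁ * Q₁ᴴ + Q₂ * Q₂ᴴ = 1)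
    (D : Matrix γ (ν ⊕ σ) F) {N : Matrix ρ γ F} {K : Matrix ρ σ F} {T : Matrix σ σ F} {α : F}
    (hα : α ≠ 0) (hN : N * Gₕ = K * (T * Q₁ᴴ)) :
    N * D = fromCols (α⁻¹ • (N * G₀)) K *
      (fromBlocks (α • 1) 0 0 T * (fromRows H₀ (Q₁ᴴ * Hₕ) * D)) := by
  conv_lhs => rw [trim_decompose hG hQ D]
  rw [Matrix.mul_add, ← Matrix.mul_assoc N (Gₕ * Q₂), ← Matrix.mul_assoc N Gₕ, hN,
    ← Matrix.mul_assoc N, mul_fromCols, ← Matrix.mul_assoc N Gₕ, hN,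
    ← Matrix.mul_assoc _ (fromBlocks _ _ _ _), fromCols_mul_fromBlocks]
  simp only [Matrix.mul_assoc, h₁₁, h₁₂]
  simp [hα]

end Trim

section Kron

variable {k m n : ℕ}

lemma kronId_mul (M N : Matrix (Fin k) (Fin k) F) :
    (kronId M * kronId N : Matrix (Fin k × Fin m) (Fin k × Fin m) F) = kronId (M * N) := by
  ext ⟨i, a⟩ ⟨j, b⟩
  by_cases h : a = b <;> simp [mul_apply, kronId, Fintype.sum_prod_type, h]

lemma kronId_one : (kronId 1 : Matrix (Fin k × Fin m) (Fin k × Fin m) F) = 1 := by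
  ext ⟨i, a⟩ ⟨j, b⟩
  by_cases h : a = b <;> simp [kronId, one_apply, h]

lemma wkron_mul_kronId (w : Fin k → F) (P : Matrix (Fin m) (Fin n) F[X])
    (M : Matrix (Fin k) (Fin k) F) :
    wkron w P * (kronId Mᵀ : Matrix (Fin k × Fin n) (Fin k × Fin n) F).map C = wkron (M *ᵥ w) P := by
  ext1 r ⟨i, c⟩
  simp only [mul_apply, wkron, kronId, of_apply, map_apply, Fintype.sum_prod_type, transpose_apply,
    apply_ite C, map_zero, mul_ite, mul_zero, Finset.sum_ite_eq', Finset.mem_univ, if_true,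
    mulVec, dotProduct, map_sum, map_mul, Finset.sum_mul]
  exact Finset.sum_congr rfl fun j _ => by ring

/-- The constant matrix `wᵀ ⊗ I_n`. -/
def wrow (n : ℕ) (w : Fin k → F) : Matrix (Fin n) (Fin k × Fin n) F :=
  Matrix.of fun r p => if r = p.2 then w p.1 else 0

lemma wrow_mul_kronId (w : Fin k → F) (M : Matrix (Fin k) (Fin k) F) :
    wrow n w * (kronId Mᵀ : Matrix (Fin k × Fin n) (Fin k × Fin n) F) = wrow n (M *ᵥ w) := by
  ext r ⟨i, c⟩
  by_cases h : r = c <;>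
    simp [mul_apply, wrow, kronId, Fintype.sum_prod_type, mulVec, dotProduct, h, mul_comm]

lemma wrow_e1 (hk : 0 < k) (α : F) :
    wrow n (e1 α : Fin k → F) = α • (sel F (fstBlock (m := n) hk))ᵀ := by
  ext r ⟨i, c⟩
  have hi0 : (i = ⟨0, hk⟩) = ((i : ℕ) = 0) := propext Fin.ext_iff
  by_cases h : c = r <;> by_cases hi : (i : ℕ) = 0 <;>
    simp [wrow, e1, sel, fstBlock, h, hi, hi0, eq_comm (a := r)]

lemma LvPoly_eq_mulVec {γ : Type*} [Fintype γ] (w : Fin k → F) (D : Matrix (Fin k × Fin n) γ F)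
    (x : γ → F[X]) :
    LvPoly w (fun p => ∑ s, C (D p s) * x s) = (wrow n w * D).map C *ᵥ x := by
  ext1 r
  simp only [LvPoly, mulVec, dotProduct, map_apply, mul_apply, wrow, of_apply,
    Fintype.sum_prod_type, ite_mul, zero_mul, Finset.sum_ite_eq, Finset.mem_univ, if_true,
    map_sum, map_mul, Finset.sum_mul, Finset.mul_sum]
  rw [Finset.sum_comm]
  exact Finset.sum_congr rfl fun s _ => Finset.sum_congr rfl fun i _ => by ring

lemma sel_map_C {ρ σ : Type*} [DecidableEq ρ] (f : σ → ρ) : (sel F f).map C = sel F[X] f := by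
  ext1 i j
  simp [sel, apply_ite C]

lemma sel_transpose_mul_sel_self {ρ σ : Type*} [Fintype ρ] [DecidableEq ρ] [DecidableEq σ]
    {f : σ → ρ} (hf : Function.Injective f) : (sel F f)ᵀ * sel F f = 1 := by
  ext i j
  rw [sel_transpose_mul]
  simp [sel, one_apply, hf.eq_iff]

lemma sel_transpose_mul_sel_of_ne {ρ σ τ : Type*} [Fintype ρ] [DecidableEq ρ]
    {f : σ → ρ} {g : τ → ρ} (h : ∀ i j, f i ≠ g j) : (sel F f)ᵀ * sel F g = 0 := by
  ext i j
  rw [sel_transpose_mul]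
  simp [sel, h]

lemma trimAux2_eq {c : ℕ} (hk : 0 < k) (M : Matrix (Fin k) (Fin k) F)
    (Q : Matrix (Fin (k - 1) × Fin n) ((Fin (k - 1) × Fin m) ⊕ Fin c) F)
    (D : Matrix (Fin k × Fin n) (Fin n ⊕ (Fin (k - 1) × Fin m)) F) :
    trimAux2 M Q D = fromCols D ((kronId Mᵀ : Matrix (Fin k × Fin n) (Fin k × Fin n) F) *
      (sel F hi : Matrix (Fin k × Fin n) (Fin (k - 1) × Fin n) F) * Q.toCols₂) := by
  have : rightCols M Q = (kronId Mᵀ : Matrix (Fin k × Fin n) (Fin k × Fin n) F) *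
      (sel F hi : Matrix (Fin k × Fin n) (Fin (k - 1) × Fin n) F) * Q.toCols₂ := by
    rw [rightCols, Matrix.mul_assoc]
    congr 1
    ext q j
    rcases eq_fstBlock_or_eq_hi hk q with hq | ⟨i, rfl⟩
    · rw [hq, sel_mul_apply_of_ne (fstBlock_ne_hi hk _)]
      simp [fstBlock]
    · rw [sel_mul_apply hi_injective]
      simp [hi]
  rw [← this]
  ext q (s | s) <;> rfl

end Kron

/-- Normal form of a trimmed pencil in `𝕃₂(P)`: up to a constant nonsingular column
transformation `S` it is `[λ B₁ + B₀ | λ KX + KY]` with `(Λ_kᵀ ⊗ I_m)(λ B₁ + B₀) = P`. -/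
lemma exists_trimmed_form {k m n c : ℕ} (hk : 0 < k) {P : Matrix (Fin m) (Fin n) F[X]}
    {Xc Yc : Matrix (Fin k × Fin m) (Fin k × Fin n) F} {w : Fin k → F}
    (hL : LeftAnsatz P (pencil Xc Yc) w) {M : Matrix (Fin k) (Fin k) F} (hM : IsUnit M)
    {α : F} (hα : α ≠ 0) (hMw : M.mulVec w = e1 α)
    {Q : Matrix (Fin (k - 1) × Fin n) ((Fin (k - 1) × Fin m) ⊕ Fin c) F}
    (hQl : Qᴴ * Q = 1) (hQr : Q * Qᴴ = 1)
    {R : Matrix (Fin (k - 1) × Fin m) (Fin (k - 1) × Fin m) F} (hR : IsUnit R)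
    (hQR : (Zmat2 M Yc)ᴴ =
      Q * (fromRows R 0 : Matrix ((Fin (k - 1) × Fin m) ⊕ Fin c) (Fin (k - 1) × Fin m) F))
    {D : Matrix (Fin k × Fin n) (Fin n ⊕ (Fin (k - 1) × Fin m)) F}
    {B : Matrix ((Fin n ⊕ (Fin (k - 1) × Fin m)) ⊕ Fin c) (Fin k × Fin n) F}
    (hD : trimAux2 M Q D * B = 1) :
    ∃ (B₁ B₀ : Matrix (Fin k × Fin m) (Fin n) F)
      (S S' : Matrix (Fin n ⊕ (Fin (k - 1) × Fin m)) (Fin n ⊕ (Fin (k - 1) × Fin m)) F),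
      S * S' = 1 ∧ Xc * D = fromCols B₁ (KX F k m) * S ∧ Yc * D = fromCols B₀ (KY F k m) * S ∧
        LamRow F k m * pencil B₁ B₀ = P ∧
        (fromCols 1 0 : Matrix (Fin n) (Fin n ⊕ (Fin (k - 1) × Fin m)) F) * S =
          wrow n w * D := by
  obtain ⟨Mi, hMi⟩ := hM.exists_right_inv
  have hMi' : Mi * M = 1 := mul_eq_one_comm.mp hMi
  obtain ⟨Ri, hRi⟩ := hR.exists_left_inv
  set J₀ := sel F (fstBlock (m := n) hk) with hJ₀
  set Jₕ := sel F (hi : Fin (k - 1) × Fin n → Fin k × Fin n) with hJₕ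
  have hJ₀₀ : J₀ᵀ * J₀ = 1 :=
    sel_transpose_mul_sel_self fun a b h => congrArg Prod.snd h
  have hJ₀ₕ : J₀ᵀ * Jₕ = 0 := sel_transpose_mul_sel_of_ne (fstBlock_ne_hi hk)
  have hJₕ₀ : Jₕᵀ * J₀ = 0 := sel_transpose_mul_sel_of_ne fun i j => (fstBlock_ne_hi hk j i).symm
  have hJₕₕ : Jₕᵀ * Jₕ = 1 := sel_transpose_mul_sel_self hi_injective
  have hJ : J₀ * J₀ᵀ + Jₕ * Jₕᵀ = 1 :=
    split_of_mul_eq_one (blockEquiv hk) hJ₀ₕ hJ₀₀ hJₕ₀ hJₕₕ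
  set E : Matrix (Fin k × Fin n) (Fin k × Fin n) F := kronId Mᵀ with hE
  set Ei : Matrix (Fin k × Fin n) (Fin k × Fin n) F := kronId Miᵀ with hEi
  have hEE : E * Ei = 1 := by
    rw [hE, hEi, kronId_mul, ← transpose_mul, hMi', transpose_one, kronId_one]
  have hEE' : Ei * E = 1 := mul_eq_one_comm.mp hEE
  have hconj {σ τ : Type} (U : Matrix σ (Fin k × Fin n) F) (V : Matrix (Fin k × Fin n) τ F) :
      U * Ei * (E * V) = U * V := by
    rw [Matrix.mul_assoc, mul_mul_cancel hEE']
  have hG : E * J₀ * (J₀ᵀ * Ei) + E * Jₕ * (Jₕᵀ * Ei) = 1 := by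
    calc _ = E * (J₀ * J₀ᵀ + Jₕ * Jₕᵀ) * Ei := by
          simp only [Matrix.mul_add, Matrix.add_mul, Matrix.mul_assoc]
      _ = 1 := by rw [hJ, Matrix.mul_one, hEE]
  have hQ : Q = fromCols Q.toCols₁ Q.toCols₂ := (fromCols_toCols Q).symm
  set Q₁ := Q.toCols₁
  set Q₂ := Q.toCols₂
  rw [hQ, conjTranspose_fromCols_eq_fromRows_conjTranspose, fromRows_mul_fromCols,
    ← fromBlocks_one, fromBlocks_inj] at hQl
  rw [hQ, conjTranspose_fromCols_eq_fromRows_conjTranspose, fromCols_mul_fromRows] at hQr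
  have hZ : Zmat2 M Yc = Rᴴ * Q₁ᴴ := by
    rw [hQ, fromCols_mul_fromRows, Matrix.mul_zero, add_zero] at hQR
    rw [← conjTranspose_mul, ← hQR, conjTranspose_conjTranspose]
  have hansatz {τ : Type} (J : Matrix (Fin k × Fin n) τ F) :
      LamRow F k m * pencil (Xc * (E * J)) (Yc * (E * J)) =
        (wkron (e1 α) P : Matrix (Fin m) (Fin k × Fin n) F[X]) * J.map C := by
    rw [pencil_mul, Matrix.map_mul, ← Matrix.mul_assoc, hL, ← Matrix.mul_assoc, hE,
      wkron_mul_kronId, hMw]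
  obtain ⟨hXh, hYh⟩ := eq_K_mul_of_LamRow_mul_eq_zero (X₂ := Xc * (E * Jₕ))
    (Y₂ := Yc * (E * Jₕ)) hk (by
      rw [hansatz, hJₕ, sel_map_C, mul_sel]
      ext1 r j
      simp [wkron, e1, hi])
  have hZY : (Yc * (E * Jₕ)).submatrix lo id = Zmat2 M Yc := by
    rw [← Matrix.mul_assoc, hJₕ, mul_sel]
    rfl
  rw [hZY, hZ] at hXh hYh
  rw [trimAux2_eq hk, ← fromRows_toRows B, fromCols_mul_fromRows] at hD
  have hS := trim_mul_eq_one (H₀ := J₀ᵀ * Ei) (Hₕ := Jₕᵀ * Ei) (G₀ := E * J₀) (Gₕ := E * Jₕ)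
    ((hconj _ _).trans hJ₀₀) ((hconj _ _).trans hJ₀ₕ) ((hconj _ _).trans hJₕ₀)
    ((hconj _ _).trans hJₕₕ) hQl.1 hQl.2.1 hD
  have hT : fromBlocks (α • (1 : Matrix (Fin n) (Fin n) F)) 0 0 Rᴴ *
      fromBlocks (α⁻¹ • (1 : Matrix (Fin n) (Fin n) F)) 0 0 Riᴴ = 1 := by
    rw [fromBlocks_multiply, ← conjTranspose_mul, hRi]
    simp [hα]
  refine ⟨α⁻¹ • (Xc * (E * J₀)), α⁻¹ • (Yc * (E * J₀)), _,
    B.toRows₁ * fromCols (E * J₀) (E * Jₕ * Q₁) *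
      fromBlocks (α⁻¹ • (1 : Matrix (Fin n) (Fin n) F)) 0 0 Riᴴ, ?_,
    mul_trim_eq hG hQl.1 hQl.2.1 hQr D hα hXh, mul_trim_eq hG hQl.1 hQl.2.1 hQr D hα hYh, ?_, ?_⟩
  · rw [Matrix.mul_assoc, ← Matrix.mul_assoc _ (B.toRows₁ * _), hS, Matrix.one_mul, hT]
  · have h1 : pencil (α⁻¹ • (Xc * (E * J₀))) (α⁻¹ • (Yc * (E * J₀))) =
        C α⁻¹ • pencil (Xc * (E * J₀)) (Yc * (E * J₀)) := by
      ext1 i j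
      simp [pencil, mul_add, mul_assoc]
    rw [h1, Matrix.mul_smul, hansatz, hJ₀, sel_map_C, mul_sel]
    ext1 r j
    simp [wkron, e1, fstBlock, ← mul_assoc, ← C_mul, hα]
  · have hw : wrow n w = α • (J₀ᵀ * Ei) := by
      rw [← Matrix.smul_mul, hJ₀, ← wrow_e1 hk, ← hMw, ← wrow_mul_kronId, Matrix.mul_assoc, hEE,
        Matrix.mul_one]
    rw [hw, ← Matrix.mul_assoc, fromCols_mul_fromBlocks, ← Matrix.mul_assoc,
      fromCols_mul_fromRows]
    simp

/-- Degrees are preserved when a right null vector of `P` is lifted to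
`[λ B₁ + B₀ | λ KX + KY] S`. -/
lemma polyVecDeg_lift {k m n : ℕ} {P : Matrix (Fin m) (Fin n) F[X]}
    {B₁ B₀ : Matrix (Fin k × Fin m) (Fin n) F}
    {S S' : Matrix (Fin n ⊕ (Fin (k - 1) × Fin m)) (Fin n ⊕ (Fin (k - 1) × Fin m)) F}
    (hS : S * S' = 1) {e : Matrix (Fin k × Fin m) (Fin m) F[X]}
    {U : Matrix (Fin (k - 1) × Fin m) (Fin k × Fin m) F[X]}
    (hB : LamRow F k m * pencil B₁ B₀ = P)
    (hsplit : e * LamRow F k m + pencil (KX F k m) (KY F k m) * U = 1)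
    (z : Fin n → F[X]) (hz : P *ᵥ z = 0) :
    polyVecDeg ((S'.map C * (fromRows 1 (-(U * pencil B₁ B₀)) :
      Matrix (Fin n ⊕ (Fin (k - 1) × Fin m)) (Fin n) F[X])) *ᵥ z) = polyVecDeg z := by
  rw [← mulVec_mulVec, fromRows_mulVec, one_mulVec]
  set u := -(U * pencil B₁ B₀) *ᵥ z with hu
  apply le_antisymm
  · refine (polyVecDeg_const_mulVec_le _ _).trans (polyVecDeg_le_iff.mpr ?_)
    have hKu : pencil (KX F k m) (KY F k m) *ᵥ u = -(pencil B₁ B₀ *ᵥ z) := by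
      have h := congrArg (· *ᵥ (pencil B₁ B₀ *ᵥ z)) hsplit
      simp only [add_mulVec, one_mulVec, ← mulVec_mulVec] at h
      rw [mulVec_mulVec _ (LamRow F k m), hB, hz, mulVec_zero, zero_add] at h
      rw [hu, neg_mulVec, mulVec_neg, ← mulVec_mulVec, h]
    have hdeg : polyVecDeg u ≤ polyVecDeg z := polyVecDeg_le_of_pencil_K_mulVec fun p => by
      rw [hKu, Pi.neg_apply, natDegree_neg]
      exact natDegree_pencil_mulVec_le _ _ _ _
    rintro (i | i)
    · exact natDegree_le_polyVecDeg z i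
    · exact (natDegree_le_polyVecDeg u i).trans hdeg
  · have hSz : S.map C *ᵥ (S'.map C *ᵥ Sum.elim z u) = Sum.elim z u := by
      rw [mulVec_mulVec, ← Matrix.map_mul, hS, Matrix.map_one _ (map_zero _) (map_one _),
        one_mulVec]
    have h := polyVecDeg_const_mulVec_le S (S'.map C *ᵥ Sum.elim z u)
    rw [hSz] at h
    exact (polyVecDeg_le_iff.mpr fun i => natDegree_le_polyVecDeg (Sum.elim z u) (Sum.inl i)).trans h

/-- Let `m ≤ n`, `nrank P = r`, and let `L = λX + Y ∈ 𝕃₂(P)` have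
nonzero left ansatz vector `w` and full `Z`-rank. Let `M̂` be nonsingular with
`M̂w = αe₁` (`α ≠ 0`), let `Ẑ* = Q [R̂ ; 0]` be a QR decomposition of the conjugate
transpose of the `Z`-matrix (`Q` unitary, `R̂` nonsingular upper triangular), and let `D̂`
be admissible, i.e. `[D̂ ∣ (M̂ᵀ ⊗ I_n)[0 ; Q₂]]` is nonsingular. Then the trimmed pencil
`L_t(λ) = L(λ) D̂` is a strong linearization of `P(λ)` satisfying the four recovery
properties (a)–(d). -/
theorem statement_14 {F : Type*} [RCLike F] {k m n : ℕ} (hk : 0 < k) (hmn : m ≤ n)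
    (r : ℕ) (A : Fin (k + 1) → Matrix (Fin m) (Fin n) F)
    (hr : nrank (matPoly A) = r)
    (Xc Yc : Matrix (Fin k × Fin m) (Fin k × Fin n) F)
    (w : Fin k → F) (hw : w ≠ 0)
    (hL : LeftAnsatz (matPoly A) (pencil Xc Yc) w)
    (M : Matrix (Fin k) (Fin k) F) (hM : IsUnit M)
    (α : F) (hα : α ≠ 0) (hMw : M.mulVec w = e1 α)
    (hrank : (Zmat2 M Yc).rank = (k - 1) * m)
    (Q : Matrix (Fin (k - 1) × Fin n)
      ((Fin (k - 1) × Fin m) ⊕ Fin ((k - 1) * (n - m))) F)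
    (hQl : Qᴴ * Q = 1) (hQr : Q * Qᴴ = 1)
    (R : Matrix (Fin (k - 1) × Fin m) (Fin (k - 1) × Fin m) F)
    (hR : IsUnit R)
    (hRtri : ∀ p q : Fin (k - 1) × Fin m,
      (q.1 : ℕ) * m + (q.2 : ℕ) < (p.1 : ℕ) * m + (p.2 : ℕ) → R p q = 0)
    (hQR : (Zmat2 M Yc)ᴴ = Q * Matrix.of (Sum.elim (fun p q => R p q) (fun _ _ => 0)))
    (D : Matrix (Fin k × Fin n) (Fin n ⊕ (Fin (k - 1) × Fin m)) F)
    (hD : ∃ B : Matrix ((Fin n ⊕ (Fin (k - 1) × Fin m)) ⊕ Fin ((k - 1) * (n - m)))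
        (Fin k × Fin n) F,
      trimAux2 M Q D * B = 1 ∧ B * trimAux2 M Q D = 1) :
    IsStrongLin ((k - 1) * m) A (pencil (Xc * D) (Yc * D)) ∧
    (∀ b : Fin (m - r) → (Fin k × Fin m → F[X]),
      IsMinimalBasis (Nl (pencil (Xc * D) (Yc * D))) b →
        ∃ y : Fin (m - r) → (Fin m → F[X]),
          IsMinimalBasis (Nl (matPoly A)) y ∧
            ∀ i, b i = fun p => Polynomial.X ^ (k - 1 - (p.1 : ℕ)) * y i p.2) ∧
    (∀ ε : Fin (m - r) → ℕ,
      HasMinIndices (Nl (matPoly A)) ε ↔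
        HasMinIndices (Nl (pencil (Xc * D) (Yc * D))) fun i => ε i + (k - 1)) ∧
    (∀ z : Fin (n - r) → (Fin n → F[X]),
      IsMinimalBasis (Nr (matPoly A)) z →
        ∃ x : Fin (n - r) → ((Fin n ⊕ (Fin (k - 1) × Fin m)) → F[X]),
          IsMinimalBasis (Nr (pencil (Xc * D) (Yc * D))) x ∧
            ∀ i, z i = LvPoly w fun p => ∑ s, Polynomial.C (D p s) * x i s) ∧
    (∀ δ : Fin (n - r) → ℕ,
      HasMinIndices (Nr (matPoly A)) δ ↔
        HasMinIndices (Nr (pencil (Xc * D) (Yc * D))) δ) := by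
  obtain ⟨B, hDB, -⟩ := hD
  obtain ⟨B₁, B₀, S, S', hS, hX, hY, hB, hwD⟩ := exists_trimmed_form hk hL hM hα hMw hQl hQr hR
    (hQR.trans (congrArg (fun T : Matrix _ _ F => Q * T) (by ext (i | i) j <;> rfl))) hDB
  have hN : pencil (Xc * D) (Yc * D) =
      fromCols (pencil B₁ B₀) (pencil (KX F k m) (KY F k m)) * S.map C := by
    rw [hX, hY, pencil_mul, pencil_fromCols]
  have hNrev : revMat 1 (pencil (Xc * D) (Yc * D)) =
      fromCols (pencil B₀ B₁) (pencil (KY F k m) (KX F k m)) * S.map C := by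
    rw [revMat_pencil, hX, hY, pencil_mul, pencil_fromCols]
  have hBrev : LamRevRow F k m * pencil B₀ B₁ = revMat k (matPoly A) := by
    rw [← hB, revMat_LamRow_mul_pencil]
  have hSC : S.map C * S'.map C = (1 : Matrix _ _ F[X]) := by
    rw [← Matrix.map_mul, hS, Matrix.map_one _ (map_zero _) (map_one _)]
  have hsplit := split_of_mul_eq_one (blockEquiv (m := m) hk) (LamRow_mul_pencil_K (F := F))
    (LamRow_mul_sel hk) (KInv_mul_sel hk) KInv_mul_pencil_K
  have hdata := DiagData.mk_of_split LamRow_mul_pencil_K (LamRow_mul_sel hk) (KInv_mul_sel hk)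
    KInv_mul_pencil_K hsplit hB hSC
  have hdataRev := DiagData.mk_of_split LamRevRow_mul_pencil_K (LamRevRow_mul_sel hk)
    (KRevInv_mul_sel hk) KRevInv_mul_pencil_K
    (split_of_mul_eq_one (blockEquiv (m := m) hk) (LamRevRow_mul_pencil_K (F := F))
      (LamRevRow_mul_sel hk) (KRevInv_mul_sel hk) KRevInv_mul_pencil_K) hBrev hSC
  rw [← hN] at hdata
  rw [← hNrev] at hdataRev
  have hleft := hdata.nullEquiv_left
  have hright := hdata.nullEquiv_right
  have hdegL (x : Fin m → F[X]) (_ : (matPoly A)ᵀ *ᵥ x = 0) (hx : x ≠ 0) :=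
    polyVecDeg_LamRow_transpose_mulVec hk hx
  have hdegR (x : Fin n → F[X]) (hx : matPoly A *ᵥ x = 0) (_ : x ≠ 0) :=
    polyVecDeg_lift hS hB hsplit x hx
  have hΨ : (fromCols 1 0 : Matrix (Fin n) (Fin n ⊕ (Fin (k - 1) × Fin m)) F[X]) * S.map C =
      (wrow n w * D).map C := by
    rw [← hwD, Matrix.map_mul]
    congr 1
    ext1 i (j | j)
    · simp [one_apply, apply_ite C]
    · simp
  let er := (blockEquiv (m := m) hk).trans (Equiv.sumCongr (Equiv.refl _) finProdFinEquiv)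
  let ec := Equiv.sumCongr (Equiv.refl (Fin n)) (finProdFinEquiv (m := k - 1) (n := m))
  refine ⟨⟨hdata.isLin er ec finProdFinEquiv, hdataRev.isLin er ec finProdFinEquiv⟩,
    fun b hb => ⟨_, hleft.symm.isMinimalBasis (hleft.degree_symm (a := 0) hdegL) hb, fun i => ?_⟩,
    hleft.hasMinIndices_iff hdegL,
    fun z hz => ⟨_, hright.isMinimalBasis (a := 0) (c := 0) hdegR hz, fun i => ?_⟩,
    hright.hasMinIndices_iff (c := 0) hdegR⟩
  · rw [← LamRow_transpose_mulVec]
    exact (hleft.symm.poly_cancel (IsPolyBasis.mulVec_eq_zero hb.1 i)).symm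
  · rw [LvPoly_eq_mulVec, ← hΨ]
    exact (hright.poly_cancel (hz.1.mulVec_eq_zero i)).symm

end GLin
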